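/- Let n ≥ 9 be an integer and p a real number with 1 < p < (n+8)/(n−8). If u : ℝⁿ → ℝ is a C^∞ solution of Δ⁴u = |u|^{p−1}u on ℝⁿ that is stable outside a compact set, then u ≡ 0. -/

import Mathlib

open MeasureTheory Real

noncomputable def lap {n : ℕ} (f : EuclideanSpace ℝ (Fin n) → ℝ) :
    EuclideanSpace ℝ (Fin n) → ℝ :=
  fun x => ∑ i : Fin n,
    iteratedFDeriv ℝ 2 f x ![EuclideanSpace.single i 1, EuclideanSpace.single i 1]

namespace LaneEmden

variable {n : ℕ}

/-- Smooth real functions on `ℝⁿ`. -/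
def Smooth (f : EuclideanSpace ℝ (Fin n) → ℝ) : Prop := ContDiff ℝ (⊤ : ℕ∞) f

/-- The partial derivative in the `i`-th coordinate direction. -/
noncomputable def pd (i : Fin n) (f : EuclideanSpace ℝ (Fin n) → ℝ) :
    EuclideanSpace ℝ (Fin n) → ℝ :=
  fun x => fderiv ℝ f x (EuclideanSpace.single i 1)

section Calculus

variable {f g : EuclideanSpace ℝ (Fin n) → ℝ}

lemma Smooth.differentiable (hf : Smooth f) : Differentiable ℝ f :=
  ContDiff.differentiable hf (by simp)

lemma Smooth.continuous (hf : Smooth f) : Continuous f := ContDiff.continuous hf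

lemma Smooth.add (hf : Smooth f) (hg : Smooth g) : Smooth (fun x => f x + g x) :=
  ContDiff.add hf hg

lemma Smooth.sub (hf : Smooth f) (hg : Smooth g) : Smooth (fun x => f x - g x) :=
  ContDiff.sub hf hg

lemma Smooth.mul (hf : Smooth f) (hg : Smooth g) : Smooth (fun x => f x * g x) :=
  ContDiff.mul hf hg

lemma Smooth.pow (hf : Smooth f) (k : ℕ) : Smooth (fun x => f x ^ k) :=
  ContDiff.pow hf k

lemma Smooth.const (c : ℝ) : Smooth (fun _ : EuclideanSpace ℝ (Fin n) => c) :=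
  contDiff_const

lemma Smooth.sum {ι : Type*} {s : Finset ι} {F : ι → EuclideanSpace ℝ (Fin n) → ℝ}
    (hF : ∀ i ∈ s, Smooth (F i)) : Smooth (fun x => ∑ i ∈ s, F i x) :=
  ContDiff.sum hF

lemma Smooth.coord (i : Fin n) : Smooth (fun x : EuclideanSpace ℝ (Fin n) => x i) := by
  unfold Smooth; fun_prop

lemma Smooth.pd (hf : Smooth f) (i : Fin n) : Smooth (pd i f) := by
  have h : ContDiff ℝ (⊤ : ℕ∞) (fderiv ℝ f) := by
    apply ContDiff.fderiv_right (m := (⊤ : ℕ∞)) hf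
    simp
  exact h.clm_apply contDiff_const

lemma pd_add (hf : Smooth f) (hg : Smooth g) (i : Fin n) :
    pd i (fun x => f x + g x) = fun x => pd i f x + pd i g x := by
  funext x
  simp [pd, fderiv_fun_add (hf.differentiable x) (hg.differentiable x)]

lemma pd_sub (hf : Smooth f) (hg : Smooth g) (i : Fin n) :
    pd i (fun x => f x - g x) = fun x => pd i f x - pd i g x := by
  funext x
  simp [pd, fderiv_fun_sub (hf.differentiable x) (hg.differentiable x)]

lemma pd_mul_apply {x : EuclideanSpace ℝ (Fin n)} (hf : DifferentiableAt ℝ f x)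
    (hg : DifferentiableAt ℝ g x) (i : Fin n) :
    pd i (fun x => f x * g x) x = pd i f x * g x + f x * pd i g x := by
  simp [pd, fderiv_fun_mul hf hg]; ring

lemma pd_mul (hf : Smooth f) (hg : Smooth g) (i : Fin n) :
    pd i (fun x => f x * g x) = fun x => pd i f x * g x + f x * pd i g x := by
  funext x
  exact pd_mul_apply (hf.differentiable x) (hg.differentiable x) i

lemma pd_const (c : ℝ) (i : Fin n) :
    pd i (fun _ : EuclideanSpace ℝ (Fin n) => c) = fun _ => 0 := by
  funext x
  simp [pd]

lemma pd_const_mul (hf : Smooth f) (c : ℝ) (i : Fin n) :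
    pd i (fun x => c * f x) = fun x => c * pd i f x := by
  funext x
  simp [pd, fderiv_const_mul (hf.differentiable x)]

lemma pd_pow (hf : Smooth f) (k : ℕ) (i : Fin n) :
    pd i (fun x => f x ^ k) = fun x => k * f x ^ (k - 1) * pd i f x := by
  funext x
  simp [pd, fderiv_fun_pow k (hf.differentiable x)]

lemma pd_sum {ι : Type*} {s : Finset ι} {F : ι → EuclideanSpace ℝ (Fin n) → ℝ}
    (hF : ∀ i ∈ s, Smooth (F i)) (i : Fin n) :
    pd i (fun x => ∑ j ∈ s, F j x) = fun x => ∑ j ∈ s, pd i (F j) x := by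
  funext x
  simp [pd, fderiv_fun_sum (fun j hj => (hF j hj).differentiable x)]

lemma pd_coord (i j : Fin n) :
    pd i (fun x : EuclideanSpace ℝ (Fin n) => x j) = fun _ => if j = i then 1 else 0 := by
  funext x
  have : (fun x : EuclideanSpace ℝ (Fin n) => x j) = EuclideanSpace.proj (𝕜 := ℝ) j := rfl
  rw [pd, this, ContinuousLinearMap.fderiv]
  simp

lemma pd_pd_eq (hf : Smooth f) (i j : Fin n) (x : EuclideanSpace ℝ (Fin n)) :
    pd i (pd j f) x = fderiv ℝ (fderiv ℝ f) x (EuclideanSpace.single i 1)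
      (EuclideanSpace.single j 1) := by
  have h : ContDiff ℝ (⊤ : ℕ∞) (fderiv ℝ f) :=
    ContDiff.fderiv_right (m := (⊤ : ℕ∞)) hf (by simp)
  have hd : DifferentiableAt ℝ (fderiv ℝ f) x := h.differentiable (by simp) x
  change fderiv ℝ (fun y => fderiv ℝ f y (EuclideanSpace.single j 1)) x _ = _
  rw [fderiv_clm_apply hd (differentiableAt_const _)]
  simp

lemma pd_comm (hf : Smooth f) (i j : Fin n) : pd i (pd j f) = pd j (pd i f) := by
  funext x
  rw [pd_pd_eq hf, pd_pd_eq hf]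
  have : IsSymmSndFDerivAt ℝ f x :=
    ContDiffAt.isSymmSndFDerivAt (n := (⊤ : ℕ∞)) (ContDiff.contDiffAt hf)
      (by
        rw [minSmoothness_of_isRCLikeNormedField]
        exact WithTop.coe_le_coe.2 (le_top (a := (2 : ℕ∞))))
  exact this _ _

lemma lap_eq (hf : Smooth f) : lap f = fun x => ∑ i, pd i (pd i f) x := by
  funext x
  refine Finset.sum_congr rfl fun i _ => ?_
  rw [iteratedFDeriv_two_apply, pd_pd_eq hf]
  simp

lemma Smooth.lap (hf : Smooth f) : Smooth (lap f) := by
  rw [lap_eq hf]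
  exact Smooth.sum fun i _ => (hf.pd i).pd i

lemma pd_lap (hf : Smooth f) (i : Fin n) : pd i (lap f) = lap (pd i f) := by
  rw [lap_eq hf, lap_eq (hf.pd i), pd_sum (fun j _ => (hf.pd j).pd j)]
  funext x
  refine Finset.sum_congr rfl fun j _ => ?_
  rw [pd_comm (hf.pd j) i j, pd_comm hf i j]

lemma lap_add (hf : Smooth f) (hg : Smooth g) :
    lap (fun x => f x + g x) = fun x => lap f x + lap g x := by
  rw [lap_eq hf, lap_eq hg, lap_eq (hf.add hg)]
  funext x
  rw [← Finset.sum_add_distrib]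
  refine Finset.sum_congr rfl fun j _ => ?_
  rw [pd_add hf hg, pd_add (hf.pd j) (hg.pd j)]

lemma lap_sub (hf : Smooth f) (hg : Smooth g) :
    lap (fun x => f x - g x) = fun x => lap f x - lap g x := by
  rw [lap_eq hf, lap_eq hg, lap_eq (hf.sub hg)]
  funext x
  rw [← Finset.sum_sub_distrib]
  refine Finset.sum_congr rfl fun j _ => ?_
  rw [pd_sub hf hg, pd_sub (hf.pd j) (hg.pd j)]

lemma lap_const_mul (hf : Smooth f) (c : ℝ) :
    lap (fun x => c * f x) = fun x => c * lap f x := by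
  rw [lap_eq hf, lap_eq ((Smooth.const c).mul hf)]
  funext x
  rw [Finset.mul_sum]
  refine Finset.sum_congr rfl fun j _ => ?_
  rw [pd_const_mul hf, pd_const_mul (hf.pd j)]

lemma lap_sum {ι : Type*} {s : Finset ι} {F : ι → EuclideanSpace ℝ (Fin n) → ℝ}
    (hF : ∀ i ∈ s, Smooth (F i)) :
    lap (fun x => ∑ j ∈ s, F j x) = fun x => ∑ j ∈ s, lap (F j) x := by
  rw [lap_eq (Smooth.sum hF)]
  funext x
  have : ∀ j ∈ s, lap (F j) x = ∑ i, pd i (pd i (F j)) x := fun j hj => by rw [lap_eq (hF j hj)]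
  rw [Finset.sum_congr rfl this, Finset.sum_comm]
  refine Finset.sum_congr rfl fun j _ => ?_
  rw [pd_sum hF, pd_sum (fun i hi => (hF i hi).pd j)]

lemma lap_coord_mul (hf : Smooth f) (j : Fin n) :
    lap (fun x => x j * f x) = fun x => x j * lap f x + 2 * pd j f x := by
  rw [lap_eq hf, lap_eq ((Smooth.coord j).mul hf)]
  funext x
  have : ∀ i, pd i (pd i (fun x => x j * f x)) x
      = x j * pd i (pd i f) x + (if j = i then 2 * pd i f x else 0) := by
    intro i
    rw [pd_mul (Smooth.coord j) hf, pd_coord,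
      pd_add ((Smooth.const _).mul hf) ((Smooth.coord j).mul (hf.pd i)),
      pd_mul (Smooth.coord j) (hf.pd i), pd_const_mul hf, pd_coord]
    split_ifs <;> ring
  simp_rw [this, Finset.sum_add_distrib, Finset.mul_sum]
  simp

/-- The Euler field commutes with the Laplacian up to `2 Δ`. -/
lemma lap_euler (hf : Smooth f) :
    lap (fun x => ∑ j, x j * pd j f x) = fun x => (∑ j, x j * pd j (lap f) x) + 2 * lap f x := by
  rw [lap_sum (fun j _ => (Smooth.coord j).mul (hf.pd j))]
  funext x
  have : lap f x = ∑ j, pd j (pd j f) x := by rw [lap_eq hf]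
  rw [this, Finset.mul_sum, ← Finset.sum_add_distrib]
  refine Finset.sum_congr rfl fun j _ => ?_
  rw [lap_coord_mul (hf.pd j), pd_lap hf]

lemma Smooth.euler (hf : Smooth f) : Smooth (fun x => ∑ j, x j * LaneEmden.pd j f x) :=
  Smooth.sum fun j _ => (Smooth.coord j).mul (hf.pd j)

lemma lap_lap_euler (hf : Smooth f) :
    lap (lap (fun x => ∑ j, x j * pd j f x))
      = fun x => (∑ j, x j * pd j (lap (lap f)) x) + 4 * lap (lap f) x := by
  rw [lap_euler hf, lap_add hf.lap.euler ((Smooth.const 2).mul hf.lap), lap_euler hf.lap,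
    lap_const_mul hf.lap]
  funext x
  ring

/-- `pd` and `lap` are local. -/
lemma pd_congr {s : Set (EuclideanSpace ℝ (Fin n))} (hs : IsOpen s) (h : Set.EqOn f g s)
    (i : Fin n) : Set.EqOn (pd i f) (pd i g) s := by
  intro x hx
  have : f =ᶠ[nhds x] g := Filter.eventuallyEq_of_mem (hs.mem_nhds hx) h
  simp only [pd, this.fderiv_eq]

lemma lap_congr {s : Set (EuclideanSpace ℝ (Fin n))} (hs : IsOpen s) (h : Set.EqOn f g s)
    (hf : Smooth f) (hg : Smooth g) : Set.EqOn (lap f) (lap g) s := by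
  intro x hx
  rw [lap_eq hf, lap_eq hg]
  exact Finset.sum_congr rfl fun i _ => pd_congr hs (pd_congr hs h i) i hx

lemma hasCompactSupport_pd (hf : HasCompactSupport f) (i : Fin n) :
    HasCompactSupport (pd i f) :=
  hf.fderiv_apply ℝ _

lemma hasCompactSupport_lap (hf : HasCompactSupport f) (hs : Smooth f) :
    HasCompactSupport (lap f) := by
  refine HasCompactSupport.intro (K := tsupport f) hf fun x hx => ?_
  have h0 : Set.EqOn f (fun _ => 0) (tsupport f)ᶜ := fun y hy => image_eq_zero_of_notMem_tsupport hy
  rw [lap_congr (isClosed_tsupport f).isOpen_compl h0 hs (Smooth.const 0) hx,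
    lap_eq (Smooth.const 0)]
  simp [pd_const]

lemma integral_pd_eq_zero (hf : ContDiff ℝ 1 f) (hc : HasCompactSupport f) (i : Fin n) :
    ∫ x, pd i f x = 0 := by
  have hi : Integrable (fun x => fderiv ℝ f x (EuclideanSpace.single i 1)) :=
    ((hf.continuous_fderiv (by simp)).clm_apply continuous_const).integrable_of_hasCompactSupport
      (hc.fderiv_apply ℝ _)
  have := integral_mul_fderiv_eq_neg_fderiv_mul_of_integrable (μ := volume) (𝕜 := ℝ)
    (f := fun _ : EuclideanSpace ℝ (Fin n) => (1 : ℝ)) (g := f)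
    (v := EuclideanSpace.single i 1) (by simp) (by simpa using hi)
    (by simpa using hf.continuous.integrable_of_hasCompactSupport hc) (fun x _ => by simp)
    (fun x _ => hf.differentiable (by simp) x)
  simpa [pd] using this

lemma Smooth.integrable_mul (hf : Smooth f) (hg : Smooth g) (hc : HasCompactSupport g) :
    Integrable (fun x => f x * g x) :=
  (hf.continuous.mul hg.continuous).integrable_of_hasCompactSupport hc.mul_left

lemma integral_pd_mul (hf : Smooth f) (hg : Smooth g) (hc : HasCompactSupport g) (i : Fin n) :
    ∫ x, pd i f x * g x = - ∫ x, f x * pd i g x := by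
  have h := integral_pd_eq_zero (f := fun x => f x * g x)
    ((hf.mul hg).of_le (by exact_mod_cast le_top)) hc.mul_left i
  rw [pd_mul hf hg, integral_add ((hf.pd i).integrable_mul hg hc)
    (hf.integrable_mul (hg.pd i) (hasCompactSupport_pd hc i))] at h
  linarith

lemma integral_lap_mul (hf : Smooth f) (hg : Smooth g) (hc : HasCompactSupport g) :
    ∫ x, lap f x * g x = ∫ x, f x * lap g x := by
  rw [lap_eq hf, lap_eq hg]
  simp_rw [Finset.sum_mul, Finset.mul_sum]
  rw [integral_finsetSum _ fun i _ => ((hf.pd i).pd i).integrable_mul hg hc,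
    integral_finsetSum _ fun i _ => hf.integrable_mul ((hg.pd i).pd i)
      (hasCompactSupport_pd (hasCompactSupport_pd hc i) i)]
  refine Finset.sum_congr rfl fun i _ => ?_
  rw [integral_pd_mul (hf.pd i) hg hc, integral_pd_mul hf (hg.pd i) (hasCompactSupport_pd hc i)]
  ring

/-- Weak form of the fourth iterate of the Laplacian. -/
lemma integral_lap_four_mul (hf : Smooth f) (hg : Smooth g) (hc : HasCompactSupport g) :
    ∫ x, lap^[4] f x * g x = ∫ x, lap (lap f) x * lap (lap g) x := by
  change ∫ x, lap (lap (lap (lap f))) x * g x = _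
  rw [integral_lap_mul hf.lap.lap.lap hg hc,
    integral_lap_mul hf.lap.lap hg.lap (hasCompactSupport_lap hc hg)]

end Calculus

/-- The sum of the squares of all partial derivatives of order `k`. -/
noncomputable def gradSq : ℕ → (EuclideanSpace ℝ (Fin n) → ℝ) → EuclideanSpace ℝ (Fin n) → ℝ
  | 0, f => fun x => f x ^ 2
  | k + 1, f => fun x => ∑ i, gradSq k (pd i f) x

/-- A smooth cutoff between the balls of radius one and two. -/
structure IsCutoff (ζ : EuclideanSpace ℝ (Fin n) → ℝ) : Prop where
  smooth : Smooth ζ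
  nonneg : ∀ x, 0 ≤ ζ x
  le_one : ∀ x, ζ x ≤ 1
  eq_one : ∀ x, ‖x‖ ≤ 1 → ζ x = 1
  eq_zero : ∀ x, 2 ≤ ‖x‖ → ζ x = 0

/-- The integral of `F` against the weight `ζ ^ (2 * s)`. -/
noncomputable def wInt (ζ : EuclideanSpace ℝ (Fin n) → ℝ) (s : ℕ)
    (F : EuclideanSpace ℝ (Fin n) → ℝ) : ℝ :=
  ∫ x, ζ x ^ (2 * s) * F x

/-- `X` interpolates between `Y` and `Z`, with an arbitrarily small multiple of `Y`. -/
def Interp (X Y Z : (EuclideanSpace ℝ (Fin n) → ℝ) → ℝ) : Prop :=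
  ∀ ε > 0, ∃ C ≥ 0, ∀ f, Smooth f → X f ≤ ε * Y f + C * Z f

section GradSq

variable {f : EuclideanSpace ℝ (Fin n) → ℝ}

lemma gradSq_nonneg (k : ℕ) (f : EuclideanSpace ℝ (Fin n) → ℝ) (x : EuclideanSpace ℝ (Fin n)) :
    0 ≤ gradSq k f x := by
  induction k generalizing f with
  | zero => exact sq_nonneg _
  | succ k ih => exact Finset.sum_nonneg fun i _ => ih _

lemma Smooth.gradSq (hf : Smooth f) (k : ℕ) : Smooth (gradSq k f) := by
  induction k generalizing f with
  | zero => exact hf.pow 2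
  | succ k ih => exact Smooth.sum fun i _ => ih (hf.pd i)

lemma gradSq_pd_le (k : ℕ) (f : EuclideanSpace ℝ (Fin n) → ℝ) (i : Fin n)
    (x : EuclideanSpace ℝ (Fin n)) : gradSq k (pd i f) x ≤ gradSq (k + 1) f x :=
  Finset.single_le_sum (f := fun i => gradSq k (pd i f) x)
    (fun _ _ => gradSq_nonneg k _ x) (Finset.mem_univ i)

lemma lap_sq_le (hf : Smooth f) (x : EuclideanSpace ℝ (Fin n)) :
    lap f x ^ 2 ≤ n * gradSq 2 f x := by
  rw [lap_eq hf]
  calc (∑ i, pd i (pd i f) x) ^ 2 ≤ n * ∑ i, pd i (pd i f) x ^ 2 := by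
        simpa using sq_sum_le_card_mul_sum_sq (s := Finset.univ) (f := fun i => pd i (pd i f) x)
    _ ≤ n * gradSq 2 f x := by
        gcongr
        refine Finset.sum_le_sum fun i _ => ?_
        exact gradSq_pd_le 0 (pd i f) i x

lemma gradSq_lap_le (hf : Smooth f) (k : ℕ) (x : EuclideanSpace ℝ (Fin n)) :
    gradSq k (lap f) x ≤ n * gradSq (k + 2) f x := by
  induction k generalizing f with
  | zero => exact lap_sq_le hf x
  | succ k ih =>
    change ∑ i, gradSq k (pd i (lap f)) x ≤ n * ∑ i, gradSq (k + 2) (pd i f) x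
    rw [Finset.mul_sum]
    refine Finset.sum_le_sum fun i _ => ?_
    rw [pd_lap hf]
    exact ih (hf.pd i)

end GradSq

section Weighted

variable {ζ f F G : EuclideanSpace ℝ (Fin n) → ℝ}

lemma IsCutoff.hasCompactSupport (hζ : IsCutoff ζ) : HasCompactSupport ζ :=
  HasCompactSupport.intro (isCompact_closedBall 0 2) fun x hx => hζ.eq_zero x (by
    simp only [Metric.mem_closedBall, dist_zero_right, not_le] at hx; exact hx.le)

lemma IsCutoff.pow_hasCompactSupport (hζ : IsCutoff ζ) {k : ℕ} (hk : k ≠ 0) :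
    HasCompactSupport (fun x => ζ x ^ k) :=
  hζ.hasCompactSupport.comp_left (g := fun t : ℝ => t ^ k) (by simp [hk])

lemma IsCutoff.exists_bound_pd (hζ : IsCutoff ζ) : ∃ M, ∀ i x, |pd i ζ x| ≤ M := by
  have h : ∀ i, ∃ M, ∀ x, |pd i ζ x| ≤ M := fun i =>
    (hasCompactSupport_pd hζ.hasCompactSupport i).exists_bound_of_continuous
      (hζ.smooth.pd i).continuous
  choose M hM using h
  refine ⟨∑ i, |M i|, fun i x => (hM i x).trans ((le_abs_self _).trans ?_)⟩
  exact Finset.single_le_sum (f := fun i => |M i|) (fun j _ => abs_nonneg _) (Finset.mem_univ i)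

lemma IsCutoff.integrable (hζ : IsCutoff ζ) {k : ℕ} (hk : k ≠ 0) (hF : Continuous F) :
    Integrable (fun x => ζ x ^ k * F x) :=
  ((hζ.smooth.pow k).continuous.mul hF).integrable_of_hasCompactSupport
    (hζ.pow_hasCompactSupport hk).mul_right

lemma wInt_nonneg (hζ : IsCutoff ζ) (s : ℕ) (hF : ∀ x, 0 ≤ F x) : 0 ≤ wInt ζ s F :=
  integral_nonneg fun x => mul_nonneg (pow_nonneg (hζ.nonneg x) _) (hF x)

lemma wInt_mono (hζ : IsCutoff ζ) {s : ℕ} (hs : s ≠ 0) (hF : Continuous F) (hG : Continuous G)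
    (h : ∀ x, F x ≤ G x) : wInt ζ s F ≤ wInt ζ s G :=
  integral_mono (hζ.integrable (by omega) hF) (hζ.integrable (by omega) hG) fun x =>
    mul_le_mul_of_nonneg_left (h x) (pow_nonneg (hζ.nonneg x) _)

lemma wInt_const_mul (s : ℕ) (c : ℝ) : wInt ζ s (fun x => c * F x) = c * wInt ζ s F := by
  simp only [wInt, ← integral_const_mul]
  congr 1; funext x; ring

lemma wInt_sum (hζ : IsCutoff ζ) {s : ℕ} (hs : s ≠ 0) {ι : Type*} {t : Finset ι}
    {F : ι → EuclideanSpace ℝ (Fin n) → ℝ} (hF : ∀ i, Continuous (F i)) :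
    wInt ζ s (fun x => ∑ i ∈ t, F i x) = ∑ i ∈ t, wInt ζ s (F i) := by
  simp only [wInt, Finset.mul_sum]
  exact integral_finsetSum _ fun i _ => hζ.integrable (by omega) (hF i)

lemma wInt_gradSq_succ (hζ : IsCutoff ζ) {s : ℕ} (hs : s ≠ 0) (hf : Smooth f) (k : ℕ) :
    wInt ζ s (gradSq (k + 1) f) = ∑ i, wInt ζ s (gradSq k (pd i f)) :=
  wInt_sum hζ hs fun i => ((hf.pd i).gradSq k).continuous

lemma wInt_pd_sq_le (hζ : IsCutoff ζ) {t : ℕ} (ht : t ≠ 0) {ε : ℝ} (hε : 0 < ε) :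
    ∃ C ≥ 0, ∀ f, Smooth f → ∀ i : Fin n, wInt ζ (t + 1) (fun x => pd i f x ^ 2) ≤
      ε * wInt ζ (t + 2) (fun x => pd i (pd i f) x ^ 2) + C * wInt ζ t (fun x => f x ^ 2) := by
  obtain ⟨M, hM⟩ := hζ.exists_bound_pd
  refine ⟨4 * (t + 1) ^ 2 * M ^ 2 + 1 / ε, by positivity, fun f hf i => ?_⟩
  set C := 4 * ((t : ℝ) + 1) ^ 2 * M ^ 2 + 1 / ε
  have hw : Smooth (fun x => ζ x ^ (2 * t + 2)) := hζ.smooth.pow _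
  have hG : Smooth (fun x => f x * (ζ x ^ (2 * t + 2) * pd i f x)) := hf.mul (hw.mul (hf.pd i))
  have hGc : HasCompactSupport (fun x => f x * (ζ x ^ (2 * t + 2) * pd i f x)) :=
    (hζ.pow_hasCompactSupport (by omega)).mul_right.mul_left
  have h0 := integral_pd_eq_zero (hG.of_le (by exact_mod_cast le_top)) hGc i
  have hGi : Integrable (pd i (fun x => f x * (ζ x ^ (2 * t + 2) * pd i f x))) :=
    (hG.pd i).continuous.integrable_of_hasCompactSupport (hasCompactSupport_pd hGc i)
  have i1 := hζ.integrable (k := 2 * (t + 1)) (by omega) ((hf.pd i).pow 2).continuous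
  have i2 := (hζ.integrable (k := 2 * (t + 2)) (by omega)
    (((hf.pd i).pd i).pow 2).continuous).const_mul ε
  have i3 := (hζ.integrable (k := 2 * t) (by omega) (hf.pow 2).continuous).const_mul C
  have key : ∀ x, ζ x ^ (2 * (t + 1)) * pd i f x ^ 2 ≤
      2 * pd i (fun x => f x * (ζ x ^ (2 * t + 2) * pd i f x)) x
      + (ε * (ζ x ^ (2 * (t + 2)) * pd i (pd i f) x ^ 2) + C * (ζ x ^ (2 * t) * f x ^ 2)) := by
    intro x
    rw [pd_mul hf (hw.mul (hf.pd i)), pd_mul hw (hf.pd i), pd_pow hζ.smooth]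
    simp only [show 2 * t + 2 - 1 = 2 * t + 1 by omega]
    push_cast
    have hd : pd i ζ x ^ 2 ≤ M ^ 2 := sq_le_sq' (abs_le.1 (hM i x)).1 (abs_le.1 (hM i x)).2
    generalize pd i ζ x = d at hd
    generalize pd i (pd i f) x = b
    generalize pd i f x = a
    generalize f x = y
    generalize ζ x = z
    have e : (z ^ (2 * t) * y ^ 2) = (z ^ t * y) ^ 2 := by ring
    have h1 : (4 * ((t : ℝ) + 1) ^ 2 * d ^ 2) * (z ^ t * y) ^ 2
        ≤ (4 * ((t : ℝ) + 1) ^ 2 * M ^ 2) * (z ^ t * y) ^ 2 := by gcongr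
    have h2 : 0 ≤ (z ^ (t + 1) * a + 2 * (t + 1) * d * (z ^ t * y)) ^ 2 := sq_nonneg _
    have h3 : 0 ≤ ε * (z ^ (t + 2) * b) ^ 2 + 2 * (z ^ t * y) * (z ^ (t + 2) * b)
        + 1 / ε * (z ^ t * y) ^ 2 := by
      have : ε * (z ^ (t + 2) * b) ^ 2 + 2 * (z ^ t * y) * (z ^ (t + 2) * b)
        + 1 / ε * (z ^ t * y) ^ 2 = ε * (z ^ (t + 2) * b + 1 / ε * (z ^ t * y)) ^ 2 := by
        field_simp; ring
      rw [this]; positivity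
    simp only [C]
    ring_nf at h1 h2 h3 ⊢
    linarith
  have i23 : Integrable (fun x => ε * (ζ x ^ (2 * (t + 2)) * pd i (pd i f) x ^ 2)
      + C * (ζ x ^ (2 * t) * f x ^ 2)) := i2.add i3
  have := integral_mono i1 ((hGi.const_mul 2).add i23) key
  simp only [Pi.add_apply] at this
  rw [integral_add (hGi.const_mul 2) i23, integral_add i2 i3, integral_const_mul,
    integral_const_mul, integral_const_mul, h0] at this
  simpa [wInt] using this

lemma interp_gradSq_step (hζ : IsCutoff ζ) {t : ℕ} (ht : t ≠ 0) (k : ℕ) :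
    Interp (fun f => wInt ζ (t + 1) (gradSq (k + 1) f)) (fun f => wInt ζ (t + 2) (gradSq (k + 2) f))
      (fun f => wInt ζ t (gradSq k f)) := by
  intro ε hε
  obtain ⟨C, hC, h⟩ := wInt_pd_sq_le hζ ht hε
  refine ⟨n * C, by positivity, ?_⟩
  induction k with
  | zero =>
    intro f hf
    simp only []
    rw [wInt_gradSq_succ hζ (by omega) hf, wInt_gradSq_succ hζ (by omega) hf, Finset.mul_sum]
    calc ∑ i, wInt ζ (t + 1) (gradSq 0 (pd i f))
        ≤ ∑ i, (ε * wInt ζ (t + 2) (fun x => pd i (pd i f) x ^ 2)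
          + C * wInt ζ t (fun x => f x ^ 2)) := Finset.sum_le_sum fun i _ => h f hf i
      _ ≤ ∑ i, (ε * wInt ζ (t + 2) (gradSq 1 (pd i f)) + C * wInt ζ t (fun x => f x ^ 2)) := by
        gcongr with i
        exact wInt_mono hζ (by omega) (((hf.pd i).pd i).pow 2).continuous
          ((hf.pd i).gradSq 1).continuous fun x => gradSq_pd_le 0 (pd i f) i x
      _ = _ := by
        rw [Finset.sum_add_distrib]
        simp [gradSq, mul_assoc]
  | succ k ih =>
    intro f hf
    simp only [] at ih ⊢
    rw [wInt_gradSq_succ hζ (by omega) hf, wInt_gradSq_succ hζ (by omega) hf,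
      wInt_gradSq_succ hζ ht hf, Finset.mul_sum, Finset.mul_sum, ← Finset.sum_add_distrib]
    exact Finset.sum_le_sum fun i _ => ih _ (hf.pd i)

lemma Interp.trans {X Y Z W : (EuclideanSpace ℝ (Fin n) → ℝ) → ℝ} (h : Interp X Y Z)
    (h' : Interp Y W X) (hY : ∀ f, 0 ≤ Y f) : Interp Y W Z := by
  intro ε hε
  obtain ⟨C, hC, h1⟩ := h' (ε / 2) (by positivity)
  obtain ⟨D, hD, h2⟩ := h (1 / (2 * (C + 1))) (by positivity)
  refine ⟨2 * C * D, by positivity, fun f hf => ?_⟩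
  have a := h1 f hf
  have b := mul_le_mul_of_nonneg_left (h2 f hf) hC
  have c : C * (1 / (2 * (C + 1)) * Y f) ≤ 1 / 2 * Y f := by
    rw [← mul_assoc]
    refine mul_le_mul_of_nonneg_right ?_ (hY f)
    rw [mul_one_div, div_le_iff₀ (by positivity)]
    linarith
  nlinarith

lemma wInt_pd_pd_sq_le (hζ : IsCutoff ζ) {t : ℕ} (ht : t ≠ 0) :
    ∃ K ≥ 0, ∀ f, Smooth f → ∀ i j : Fin n,
      wInt ζ (t + 2) (fun x => pd j (pd i f) x ^ 2) ≤
        2 * wInt ζ (t + 2) (fun x => pd i (pd i f) x * pd j (pd j f) x)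
        + K * wInt ζ (t + 1) (fun x => pd i f x ^ 2)
        + 1 / (2 * n) * wInt ζ (t + 2) (fun x => pd j (pd j f) x ^ 2) := by
  obtain ⟨M, hM⟩ := hζ.exists_bound_pd
  refine ⟨(1 + 2 * n) * ((2 * t + 4) * M) ^ 2, by positivity, fun f hf i j => ?_⟩
  have hn : (0 : ℝ) < n := by exact_mod_cast i.pos
  set K := (1 + 2 * (n : ℝ)) * ((2 * t + 4) * M) ^ 2 with hK
  have hw : Smooth (fun x => ζ x ^ (2 * t + 4)) := hζ.smooth.pow _
  have hwi := hw.mul (hf.pd i)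
  have hij := (hf.pd i).pd j
  have hjj := (hf.pd j).pd j
  set G := fun x => (ζ x ^ (2 * t + 4) * pd i f x) * pd j (pd i f) x with hGdef
  set H := fun x => (ζ x ^ (2 * t + 4) * pd i f x) * pd j (pd j f) x with hHdef
  have hG : Smooth G := hwi.mul hij
  have hH : Smooth H := hwi.mul hjj
  have hGc : HasCompactSupport G := (hζ.pow_hasCompactSupport (by omega)).mul_right.mul_right
  have hHc : HasCompactSupport H := (hζ.pow_hasCompactSupport (by omega)).mul_right.mul_right
  have hG0 := integral_pd_eq_zero (hG.of_le (by exact_mod_cast le_top)) hGc j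
  have hH0 := integral_pd_eq_zero (hH.of_le (by exact_mod_cast le_top)) hHc i
  have hGi : Integrable (pd j G) :=
    (hG.pd j).continuous.integrable_of_hasCompactSupport (hasCompactSupport_pd hGc j)
  have hHi : Integrable (pd i H) :=
    (hH.pd i).continuous.integrable_of_hasCompactSupport (hasCompactSupport_pd hHc i)
  have i1 := hζ.integrable (k := 2 * (t + 2)) (by omega) (hij.pow 2).continuous
  have i2 := (hζ.integrable (k := 2 * (t + 2)) (by omega)
    (((hf.pd i).pd i).mul hjj).continuous).const_mul 2
  have i3 := (hζ.integrable (k := 2 * (t + 1)) (by omega) ((hf.pd i).pow 2).continuous).const_mul K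
  have i4 := (hζ.integrable (k := 2 * (t + 2)) (by omega)
    (hjj.pow 2).continuous).const_mul (1 / (2 * (n : ℝ)))
  have i5 : Integrable (fun x => 2 * (pd j G x - pd i H x)) := (hGi.sub hHi).const_mul 2
  have key : ∀ x, ζ x ^ (2 * (t + 2)) * pd j (pd i f) x ^ 2 ≤
      2 * (ζ x ^ (2 * (t + 2)) * (pd i (pd i f) x * pd j (pd j f) x))
        + K * (ζ x ^ (2 * (t + 1)) * pd i f x ^ 2)
        + 1 / (2 * n) * (ζ x ^ (2 * (t + 2)) * pd j (pd j f) x ^ 2)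
        + 2 * (pd j G x - pd i H x) := by
    intro x
    rw [hGdef, hHdef, pd_mul hwi hij, pd_mul hwi hjj, pd_mul hw (hf.pd i), pd_mul hw (hf.pd i),
      pd_pow hζ.smooth, pd_pow hζ.smooth, pd_comm hf j i, pd_comm (hf.pd j) j i]
    simp only [show 2 * t + 4 - 1 = 2 * t + 3 by omega]
    push_cast
    have hdi : pd i ζ x ^ 2 ≤ M ^ 2 := sq_le_sq' (abs_le.1 (hM i x)).1 (abs_le.1 (hM i x)).2
    have hdj : pd j ζ x ^ 2 ≤ M ^ 2 := sq_le_sq' (abs_le.1 (hM j x)).1 (abs_le.1 (hM j x)).2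
    generalize pd i ζ x = d at hdi
    generalize pd j ζ x = e at hdj
    generalize pd i (pd j (pd j f)) x = q
    generalize pd i (pd i f) x = a
    generalize pd j (pd j f) x = b
    generalize pd i (pd j f) x = c
    generalize pd i f x = y
    generalize ζ x = z
    have h1 : ((2 * (t : ℝ) + 4) ^ 2 * e ^ 2) * (z ^ (t + 1) * y) ^ 2
        ≤ ((2 * (t : ℝ) + 4) ^ 2 * M ^ 2) * (z ^ (t + 1) * y) ^ 2 := by gcongr
    have h2 : 2 * n * (((2 * (t : ℝ) + 4) ^ 2 * d ^ 2) * (z ^ (t + 1) * y) ^ 2)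
        ≤ 2 * n * (((2 * (t : ℝ) + 4) ^ 2 * M ^ 2) * (z ^ (t + 1) * y) ^ 2) := by gcongr
    have h3 : 0 ≤ (z ^ (t + 2) * c + (2 * t + 4) * e * (z ^ (t + 1) * y)) ^ 2 := sq_nonneg _
    have h4 : 0 ≤ 1 / (2 * n) * (z ^ (t + 2) * b) ^ 2
        - 2 * (2 * t + 4) * d * (z ^ (t + 1) * y) * (z ^ (t + 2) * b)
        + 2 * n * ((2 * t + 4) ^ 2 * d ^ 2 * (z ^ (t + 1) * y) ^ 2) := by
      have : 1 / (2 * n) * (z ^ (t + 2) * b) ^ 2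
        - 2 * (2 * t + 4) * d * (z ^ (t + 1) * y) * (z ^ (t + 2) * b)
        + 2 * n * ((2 * t + 4) ^ 2 * d ^ 2 * (z ^ (t + 1) * y) ^ 2)
        = 1 / (2 * n) * (z ^ (t + 2) * b - 2 * n * ((2 * t + 4) * d * (z ^ (t + 1) * y))) ^ 2 := by
        field_simp; ring
      rw [this]; positivity
    rw [hK]
    generalize 1 / (2 * (n : ℝ)) = r at h4 ⊢
    ring_nf at h1 h2 h3 h4 ⊢
    linarith
  have i23 : Integrable (fun x => 2 * (ζ x ^ (2 * (t + 2)) * (pd i (pd i f) x * pd j (pd j f) x))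
        + K * (ζ x ^ (2 * (t + 1)) * pd i f x ^ 2)) := i2.add i3
  have i234 : Integrable (fun x =>
      2 * (ζ x ^ (2 * (t + 2)) * (pd i (pd i f) x * pd j (pd j f) x))
        + K * (ζ x ^ (2 * (t + 1)) * pd i f x ^ 2)
        + 1 / (2 * n) * (ζ x ^ (2 * (t + 2)) * pd j (pd j f) x ^ 2)) := i23.add i4
  have := integral_mono i1 (i234.add i5) key
  simp only [Pi.add_apply] at this
  rw [integral_add i234 i5, integral_add i23 i4, integral_add i2 i3, integral_const_mul,
    integral_const_mul, integral_const_mul, integral_const_mul, integral_sub hGi hHi, hG0, hH0]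
    at this
  simpa only [wInt, sub_zero, mul_zero, add_zero] using this

lemma wInt_gradSq_two_le (hζ : IsCutoff ζ) {t : ℕ} (ht : t ≠ 0) :
    ∃ C ≥ 0, ∀ f, Smooth f → wInt ζ (t + 2) (gradSq 2 f) ≤
      C * (wInt ζ (t + 2) (fun x => lap f x ^ 2) + wInt ζ (t + 1) (gradSq 1 f)) := by
  obtain ⟨K, hK, h⟩ := wInt_pd_pd_sq_le hζ ht
  refine ⟨2 * (2 + n * K), by positivity, fun f hf => ?_⟩
  have e2 : wInt ζ (t + 2) (gradSq 2 f)
      = ∑ i, ∑ j, wInt ζ (t + 2) (fun x => pd j (pd i f) x ^ 2) := by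
    rw [wInt_gradSq_succ hζ (by omega) hf]
    refine Finset.sum_congr rfl fun i _ => ?_
    rw [wInt_gradSq_succ hζ (by omega) (hf.pd i)]
    rfl
  have e1 : wInt ζ (t + 1) (gradSq 1 f) = ∑ i, wInt ζ (t + 1) (fun x => pd i f x ^ 2) := by
    rw [wInt_gradSq_succ hζ (by omega) hf]
    rfl
  have eL : wInt ζ (t + 2) (fun x => lap f x ^ 2)
      = ∑ i, ∑ j, wInt ζ (t + 2) (fun x => pd i (pd i f) x * pd j (pd j f) x) := by
    rw [lap_eq hf]
    simp only [sq, Finset.sum_mul_sum]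
    rw [wInt_sum hζ (by omega) fun i => (Smooth.sum fun j _ =>
      ((hf.pd i).pd i).mul ((hf.pd j).pd j)).continuous]
    refine Finset.sum_congr rfl fun i _ => ?_
    rw [wInt_sum hζ (by omega) fun j => (((hf.pd i).pd i).mul ((hf.pd j).pd j)).continuous]
  have eD : ∑ j, wInt ζ (t + 2) (fun x => pd j (pd j f) x ^ 2) ≤ wInt ζ (t + 2) (gradSq 2 f) := by
    rw [e2]
    refine Finset.sum_le_sum fun j _ => ?_
    exact Finset.single_le_sum (f := fun k => wInt ζ (t + 2) (fun x => pd k (pd j f) x ^ 2))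
      (fun k _ => wInt_nonneg hζ _ fun x => sq_nonneg _) (Finset.mem_univ j)
  have hs := Finset.sum_le_sum fun i (_ : i ∈ (Finset.univ : Finset (Fin n))) =>
    Finset.sum_le_sum fun j (_ : j ∈ (Finset.univ : Finset (Fin n))) => h f hf i j
  simp only [Finset.sum_add_distrib, ← Finset.mul_sum] at hs
  rw [← e2, ← eL] at hs
  simp only [Finset.sum_const, Finset.card_univ, Fintype.card_fin, nsmul_eq_mul,
    ← Finset.mul_sum] at hs
  rw [← e1] at hs
  have hA : 0 ≤ wInt ζ (t + 2) (gradSq 2 f) := wInt_nonneg hζ _ (gradSq_nonneg 2 f)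
  have hL : 0 ≤ wInt ζ (t + 2) (fun x => lap f x ^ 2) := wInt_nonneg hζ _ fun x => sq_nonneg _
  have hB : 0 ≤ wInt ζ (t + 1) (gradSq 1 f) := wInt_nonneg hζ _ (gradSq_nonneg 1 f)
  have hlast : (n : ℝ) * (1 / (2 * n) * ∑ j, wInt ζ (t + 2) (fun x => pd j (pd j f) x ^ 2))
      ≤ 1 / 2 * wInt ζ (t + 2) (gradSq 2 f) := by
    rcases Nat.eq_zero_or_pos n with h0 | h0
    · have : (n : ℝ) = 0 := by exact_mod_cast h0
      rw [this]; linarith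
    · have : (0 : ℝ) < n := by exact_mod_cast h0
      rw [← mul_assoc, show (n : ℝ) * (1 / (2 * n)) = 1 / 2 by field_simp]
      linarith
  have : 0 ≤ (n : ℝ) * K := by positivity
  nlinarith [mul_nonneg this hL, mul_nonneg this hB]

/-- The seminorm `∫ ζ ^ (2 (t + k)) |∇ᵏ f|²`. -/
noncomputable def gradInt (ζ : EuclideanSpace ℝ (Fin n) → ℝ) (t k : ℕ)
    (f : EuclideanSpace ℝ (Fin n) → ℝ) : ℝ :=
  wInt ζ (t + k) (gradSq k f)

lemma gradInt_nonneg (hζ : IsCutoff ζ) (t k : ℕ) (f : EuclideanSpace ℝ (Fin n) → ℝ) :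
    0 ≤ gradInt ζ t k f :=
  wInt_nonneg hζ _ (gradSq_nonneg k f)

lemma gradInt_four_le (hζ : IsCutoff ζ) (t : ℕ) :
    ∃ C ≥ 0, ∀ f, Smooth f → gradInt ζ t 4 f ≤
      C * (wInt ζ (t + 4) (fun x => lap (lap f) x ^ 2) + gradInt ζ t 3 f) := by
  obtain ⟨C, hC, h⟩ := wInt_gradSq_two_le hζ (t := t + 2) (by omega)
  refine ⟨C ^ 2 * (1 + n) + C, by positivity, fun f hf => ?_⟩
  have h1 : gradInt ζ t 4 f ≤ C * (wInt ζ (t + 4) (gradSq 2 (lap f)) + gradInt ζ t 3 f) := by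
    have e4 : gradInt ζ t 4 f = ∑ i, ∑ j, wInt ζ (t + 4) (gradSq 2 (pd j (pd i f))) := by
      rw [gradInt, wInt_gradSq_succ hζ (by omega) hf]
      exact Finset.sum_congr rfl fun i _ => wInt_gradSq_succ hζ (by omega) (hf.pd i) _
    have e3 : gradInt ζ t 3 f = ∑ i, ∑ j, wInt ζ (t + 3) (gradSq 1 (pd j (pd i f))) := by
      rw [gradInt, wInt_gradSq_succ hζ (by omega) hf]
      exact Finset.sum_congr rfl fun i _ => wInt_gradSq_succ hζ (by omega) (hf.pd i) _
    have eL : wInt ζ (t + 4) (gradSq 2 (lap f))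
        = ∑ i, ∑ j, wInt ζ (t + 4) (fun x => lap (pd j (pd i f)) x ^ 2) := by
      rw [wInt_gradSq_succ hζ (by omega) hf.lap]
      refine Finset.sum_congr rfl fun i _ => ?_
      rw [wInt_gradSq_succ hζ (by omega) (hf.lap.pd i)]
      refine Finset.sum_congr rfl fun j _ => ?_
      rw [pd_lap hf, pd_lap (hf.pd i)]
      rfl
    rw [e4, e3, eL, ← Finset.sum_add_distrib, Finset.mul_sum]
    refine Finset.sum_le_sum fun i _ => ?_
    rw [← Finset.sum_add_distrib, Finset.mul_sum]
    exact Finset.sum_le_sum fun j _ => h _ ((hf.pd i).pd j)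
  have h2 := h _ hf.lap
  have h3 : wInt ζ (t + 2 + 1) (gradSq 1 (lap f)) ≤ n * gradInt ζ t 3 f := by
    rw [gradInt, ← wInt_const_mul]
    exact wInt_mono hζ (by omega) (hf.lap.gradSq 1).continuous
      ((Smooth.const _).mul (hf.gradSq 3)).continuous (gradSq_lap_le hf 1)
  have h4 := gradInt_nonneg hζ t 3 f
  have hL : 0 ≤ wInt ζ (t + 4) (fun x => lap (lap f) x ^ 2) :=
    wInt_nonneg hζ _ fun x => sq_nonneg _
  have h5 : wInt ζ (t + 4) (gradSq 2 (lap f)) ≤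
      C * (wInt ζ (t + 4) (fun x => lap (lap f) x ^ 2) + n * gradInt ζ t 3 f) :=
    h2.trans (by gcongr)
  calc gradInt ζ t 4 f ≤ C * (wInt ζ (t + 4) (gradSq 2 (lap f)) + gradInt ζ t 3 f) := h1
    _ ≤ C * (C * (wInt ζ (t + 4) (fun x => lap (lap f) x ^ 2) + n * gradInt ζ t 3 f)
        + gradInt ζ t 3 f) := by gcongr
    _ ≤ _ := by
      have hn : (0 : ℝ) ≤ n := by positivity
      have : 0 ≤ C ^ 2 * n * wInt ζ (t + 4) (fun x => lap (lap f) x ^ 2) := by positivity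
      have : 0 ≤ C ^ 2 * gradInt ζ t 3 f := by positivity
      have : 0 ≤ C * wInt ζ (t + 4) (fun x => lap (lap f) x ^ 2) := by positivity
      nlinarith

lemma interp_gradInt_two (hζ : IsCutoff ζ) {t : ℕ} (ht : t ≠ 0) :
    Interp (gradInt ζ t 2) (gradInt ζ t 3) (gradInt ζ t 0) :=
  (interp_gradSq_step hζ ht 0).trans (interp_gradSq_step hζ (t := t + 1) (by omega) 1)
    (gradInt_nonneg hζ t 2)

lemma interp_gradInt_three (hζ : IsCutoff ζ) {t : ℕ} (ht : t ≠ 0) :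
    Interp (gradInt ζ t 3) (gradInt ζ t 4) (gradInt ζ t 0) :=
  (interp_gradInt_two hζ ht).trans (interp_gradSq_step hζ (t := t + 2) (by omega) 2)
    (gradInt_nonneg hζ t 3)

/-- The fourth-order seminorm is controlled by the bilaplacian and the zeroth-order term. -/
lemma gradInt_four_le_bilaplacian (hζ : IsCutoff ζ) {t : ℕ} (ht : t ≠ 0) :
    ∃ C ≥ 0, ∀ f, Smooth f → gradInt ζ t 4 f ≤
      C * (wInt ζ (t + 4) (fun x => lap (lap f) x ^ 2) + gradInt ζ t 0 f) := by
  obtain ⟨C, hC, h⟩ := gradInt_four_le hζ t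
  obtain ⟨D, hD, h'⟩ := interp_gradInt_three hζ ht (1 / (2 * (C + 1))) (by positivity)
  refine ⟨2 * C + 2 * C * D, by positivity, fun f hf => ?_⟩
  have a := h f hf
  have b := mul_le_mul_of_nonneg_left (h' f hf) hC
  have c : C * (1 / (2 * (C + 1)) * gradInt ζ t 4 f) ≤ 1 / 2 * gradInt ζ t 4 f := by
    rw [← mul_assoc]
    refine mul_le_mul_of_nonneg_right ?_ (gradInt_nonneg hζ t 4 f)
    rw [mul_one_div, div_le_iff₀ (by positivity)]
    linarith
  have hL : 0 ≤ wInt ζ (t + 4) (fun x => lap (lap f) x ^ 2) :=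
    wInt_nonneg hζ _ fun x => sq_nonneg _
  have h0 := gradInt_nonneg hζ t 0 f
  have : 0 ≤ C * D * wInt ζ (t + 4) (fun x => lap (lap f) x ^ 2) := by positivity
  have : 0 ≤ C * gradInt ζ t 0 f := by positivity
  nlinarith

/-- All lower-order seminorms interpolate between the bilaplacian and the zeroth-order term. -/
lemma sum_gradInt_interp (hζ : IsCutoff ζ) {t : ℕ} (ht : t ≠ 0) :
    Interp (fun f => ∑ k ∈ Finset.range 4, gradInt ζ t k f)
      (fun f => wInt ζ (t + 4) (fun x => lap (lap f) x ^ 2)) (gradInt ζ t 0) := by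
  intro ε hε
  obtain ⟨C, hC, h4⟩ := gradInt_four_le_bilaplacian hζ ht
  obtain ⟨D₁, hD₁, h1⟩ := interp_gradSq_step hζ ht 0 1 one_pos
  obtain ⟨D₂, hD₂, h2⟩ := interp_gradInt_two hζ ht 1 one_pos
  obtain ⟨D₃, hD₃, h3⟩ := interp_gradInt_three hζ ht (ε / (3 * (C + 1))) (by positivity)
  refine ⟨1 + D₁ + 2 * D₂ + 3 * D₃ + ε, by positivity, fun f hf => ?_⟩
  have a1 : gradInt ζ t 1 f ≤ 1 * gradInt ζ t 2 f + D₁ * gradInt ζ t 0 f := h1 f hf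
  have a2 := h2 f hf
  have a3 := h3 f hf
  have h0 := gradInt_nonneg hζ t 0 f
  have hL : 0 ≤ wInt ζ (t + 4) (fun x => lap (lap f) x ^ 2) :=
    wInt_nonneg hζ _ fun x => sq_nonneg _
  have a4 : ε / (3 * (C + 1)) * gradInt ζ t 4 f ≤
      ε / 3 * (wInt ζ (t + 4) (fun x => lap (lap f) x ^ 2) + gradInt ζ t 0 f) := by
    calc ε / (3 * (C + 1)) * gradInt ζ t 4 f
        ≤ ε / (3 * (C + 1)) * (C * (wInt ζ (t + 4) (fun x => lap (lap f) x ^ 2)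
          + gradInt ζ t 0 f)) := by gcongr; exact h4 f hf
      _ ≤ ε / (3 * (C + 1)) * ((C + 1) * (wInt ζ (t + 4) (fun x => lap (lap f) x ^ 2)
          + gradInt ζ t 0 f)) := by gcongr; linarith
      _ = _ := by field_simp
  simp only [Finset.sum_range_succ, Finset.sum_range_zero, zero_add]
  linarith

end Weighted

section Commutator

variable {ζ f w : EuclideanSpace ℝ (Fin n) → ℝ}

/-- `w` is `ζ ^ s` times a smooth compactly supported function. -/
def IsWeight (ζ : EuclideanSpace ℝ (Fin n) → ℝ) (s : ℕ) (w : EuclideanSpace ℝ (Fin n) → ℝ) :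
    Prop :=
  ∃ h, Smooth h ∧ HasCompactSupport h ∧ w = fun x => ζ x ^ s * h x

/-- Iterated partial derivatives. -/
noncomputable def pdList : List (Fin n) → (EuclideanSpace ℝ (Fin n) → ℝ) →
    EuclideanSpace ℝ (Fin n) → ℝ
  | [], f => f
  | i :: I, f => pdList I (pd i f)

/-- The weighted sum of the squared derivatives of order less than `r`. -/
noncomputable def lowSq (ζ : EuclideanSpace ℝ (Fin n) → ℝ) (t r : ℕ)
    (f : EuclideanSpace ℝ (Fin n) → ℝ) (x : EuclideanSpace ℝ (Fin n)) : ℝ :=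
  ∑ k ∈ Finset.range r, ζ x ^ (2 * (t + k)) * gradSq k f x

lemma IsWeight.smooth (hζ : IsCutoff ζ) {s : ℕ} (hw : IsWeight ζ s w) : Smooth w := by
  obtain ⟨h, hh, -, rfl⟩ := hw
  exact (hζ.smooth.pow s).mul hh

lemma IsWeight.pd (hζ : IsCutoff ζ) {s : ℕ} (hw : IsWeight ζ (s + 1) w) (i : Fin n) :
    IsWeight ζ s (pd i w) := by
  obtain ⟨h, hh, hc, rfl⟩ := hw
  refine ⟨fun x => (s + 1) * LaneEmden.pd i ζ x * h x + ζ x * LaneEmden.pd i h x,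
    (((Smooth.const _).mul (hζ.smooth.pd i)).mul hh).add (hζ.smooth.mul (hh.pd i)),
    hc.mul_left.add (hasCompactSupport_pd hc i).mul_left, ?_⟩
  rw [pd_mul (hζ.smooth.pow _) hh, pd_pow hζ.smooth]
  funext x
  simp only [Nat.add_sub_cancel]
  push_cast
  ring

lemma IsWeight.smooth_mul {s : ℕ} (hw : IsWeight ζ s w) (hf : Smooth f) :
    IsWeight ζ s (fun x => f x * w x) := by
  obtain ⟨h, hh, hc, rfl⟩ := hw
  exact ⟨fun x => f x * h x, hf.mul hh, hc.mul_left, by funext x; ring⟩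

lemma IsWeight.exists_sq_le (hζ : IsCutoff ζ) {s : ℕ} (hw : IsWeight ζ s w) :
    ∃ C ≥ 0, ∀ x, w x ^ 2 ≤ C * ζ x ^ (2 * s) := by
  obtain ⟨h, hh, hc, rfl⟩ := hw
  obtain ⟨M, hM⟩ := hc.exists_bound_of_continuous hh.continuous
  refine ⟨M ^ 2, by positivity, fun x => ?_⟩
  have : h x ^ 2 ≤ M ^ 2 := sq_le_sq' (abs_le.1 (hM x)).1 (abs_le.1 (hM x)).2
  calc (ζ x ^ s * h x) ^ 2 = h x ^ 2 * ζ x ^ (2 * s) := by ring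
    _ ≤ M ^ 2 * ζ x ^ (2 * s) :=
      mul_le_mul_of_nonneg_right this (pow_nonneg (hζ.nonneg x) _)

lemma IsCutoff.isWeight_pow (hζ : IsCutoff ζ) {s : ℕ} (hs : s ≠ 0) :
    IsWeight ζ s (fun x => ζ x ^ s) := by
  let χ : ContDiffBump (0 : EuclideanSpace ℝ (Fin n)) := ⟨2, 3, by norm_num, by norm_num⟩
  refine ⟨χ, χ.contDiff, χ.hasCompactSupport, ?_⟩
  funext x
  rcases le_total ‖x‖ 2 with h | h
  · rw [χ.one_of_mem_closedBall (by simpa using h), mul_one]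
  · rw [hζ.eq_zero x h, zero_pow hs, zero_mul]

lemma lowSq_nonneg (hζ : IsCutoff ζ) (t r : ℕ) (f : EuclideanSpace ℝ (Fin n) → ℝ)
    (x : EuclideanSpace ℝ (Fin n)) : 0 ≤ lowSq ζ t r f x :=
  Finset.sum_nonneg fun _ _ => mul_nonneg (pow_nonneg (hζ.nonneg x) _) (gradSq_nonneg _ _ _)

lemma lowSq_le_succ (hζ : IsCutoff ζ) (t r : ℕ) (f : EuclideanSpace ℝ (Fin n) → ℝ)
    (x : EuclideanSpace ℝ (Fin n)) : lowSq ζ t r f x ≤ lowSq ζ t (r + 1) f x := by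
  rw [lowSq, lowSq, Finset.sum_range_succ]
  exact le_add_of_nonneg_right (mul_nonneg (pow_nonneg (hζ.nonneg x) _) (gradSq_nonneg _ _ _))

lemma lowSq_pd_le (hζ : IsCutoff ζ) (t r : ℕ) (f : EuclideanSpace ℝ (Fin n) → ℝ) (i : Fin n)
    (x : EuclideanSpace ℝ (Fin n)) : lowSq ζ (t + 1) r (pd i f) x ≤ lowSq ζ t (r + 1) f x := by
  rw [lowSq, lowSq, Finset.sum_range_succ']
  refine le_add_of_le_of_nonneg (Finset.sum_le_sum fun k _ => ?_)
    (mul_nonneg (pow_nonneg (hζ.nonneg x) _) (gradSq_nonneg _ _ _))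
  rw [show t + 1 + k = t + (k + 1) by ring]
  exact mul_le_mul_of_nonneg_left (gradSq_pd_le k f i x) (pow_nonneg (hζ.nonneg x) _)

lemma lowSq_anti (hζ : IsCutoff ζ) {s t : ℕ} (hst : s ≤ t) (r : ℕ)
    (f : EuclideanSpace ℝ (Fin n) → ℝ) (x : EuclideanSpace ℝ (Fin n)) :
    lowSq ζ t r f x ≤ lowSq ζ s r f x :=
  Finset.sum_le_sum fun k _ => mul_le_mul_of_nonneg_right
    (pow_le_pow_of_le_one (hζ.nonneg x) (hζ.le_one x) (by omega)) (gradSq_nonneg _ _ _)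

lemma pow_mul_lowSq (s t r : ℕ) (f : EuclideanSpace ℝ (Fin n) → ℝ)
    (x : EuclideanSpace ℝ (Fin n)) :
    lowSq ζ (s + t) r f x = ζ x ^ (2 * s) * lowSq ζ t r f x := by
  rw [lowSq, lowSq, Finset.mul_sum]
  refine Finset.sum_congr rfl fun k _ => ?_
  rw [← mul_assoc, ← pow_add]
  congr 2; ring

lemma pdList_add {g : EuclideanSpace ℝ (Fin n) → ℝ} (hf : Smooth f) (hg : Smooth g)
    (I : List (Fin n)) : pdList I (fun x => f x + g x) = fun x => pdList I f x + pdList I g x := by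
  induction I generalizing f g with
  | nil => rfl
  | cons i I ih =>
    simp only [pdList]
    rw [pd_add hf hg, ih (hf.pd i) (hg.pd i)]

lemma pdList_sq_le (f : EuclideanSpace ℝ (Fin n) → ℝ) (I : List (Fin n))
    (x : EuclideanSpace ℝ (Fin n)) : pdList I f x ^ 2 ≤ gradSq I.length f x := by
  induction I generalizing f with
  | nil => exact le_rfl
  | cons i I ih => exact (ih (pd i f)).trans (gradSq_pd_le _ f i x)

/-- Leibniz rule: moving a weight out of an iterated derivative costs lower-order terms. -/
lemma exists_commutator_sq_le (hζ : IsCutoff ζ) (I : List (Fin n)) (t : ℕ)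
    (hw : IsWeight ζ (t + I.length) w) : ∃ C ≥ 0, ∀ f, Smooth f → ∀ x,
      (pdList I (fun x => f x * w x) x - w x * pdList I f x) ^ 2
        ≤ C * lowSq ζ t I.length f x := by
  induction I generalizing t w with
  | nil =>
    refine ⟨0, le_rfl, fun f _ x => ?_⟩
    simp [pdList, mul_comm]
  | cons i I ih =>
    rw [List.length_cons] at hw ⊢
    obtain ⟨C₁, hC₁, h1⟩ := ih (t + 1) (by rwa [show t + 1 + I.length = t + (I.length + 1) by ring])
    have hwi : IsWeight ζ (t + I.length) (pd i w) := IsWeight.pd hζ (by rwa [← add_assoc] at hw) i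
    obtain ⟨C₂, hC₂, h2⟩ := ih t hwi
    obtain ⟨C₃, hC₃, h3⟩ := hwi.exists_sq_le hζ
    refine ⟨3 * (C₁ + C₂ + C₃), by positivity, fun f hf x => ?_⟩
    have hws := hw.smooth hζ
    have e : pdList (i :: I) (fun x => f x * w x) x - w x * pdList (i :: I) f x
        = (pdList I (fun x => pd i f x * w x) x - w x * pdList I (pd i f) x)
        + (pdList I (fun x => f x * pd i w x) x - pd i w x * pdList I f x)
        + pd i w x * pdList I f x := by
      simp only [pdList]
      rw [pd_mul hf hws, pdList_add ((hf.pd i).mul hws) (hf.mul (hws.pd i))]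
      ring
    have a1 := (h1 _ (hf.pd i) x).trans
      (mul_le_mul_of_nonneg_left (lowSq_pd_le hζ t I.length f i x) hC₁)
    have a2 := (h2 _ hf x).trans (mul_le_mul_of_nonneg_left (lowSq_le_succ hζ t I.length f x) hC₂)
    have a3 : (pd i w x * pdList I f x) ^ 2 ≤ C₃ * lowSq ζ t (I.length + 1) f x := by
      rw [mul_pow]
      calc pd i w x ^ 2 * pdList I f x ^ 2
          ≤ (C₃ * ζ x ^ (2 * (t + I.length))) * gradSq I.length f x :=
            mul_le_mul (h3 x) (pdList_sq_le f I x) (sq_nonneg _) ((sq_nonneg _).trans (h3 x))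
        _ = C₃ * (ζ x ^ (2 * (t + I.length)) * gradSq I.length f x) := by ring
        _ ≤ _ := by
          refine mul_le_mul_of_nonneg_left ?_ hC₃
          rw [lowSq, Finset.sum_range_succ]
          exact le_add_of_nonneg_left (lowSq_nonneg hζ t I.length f x)
    rw [e]
    generalize pdList I (fun x => pd i f x * w x) x - w x * pdList I (pd i f) x = p at a1
    generalize pdList I (fun x => f x * pd i w x) x - pd i w x * pdList I f x = q at a2
    generalize pd i w x * pdList I f x = r at a3
    nlinarith [sq_nonneg (p - q), sq_nonneg (q - r), sq_nonneg (p - r)]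

lemma lap_lap_eq (hf : Smooth f) (x : EuclideanSpace ℝ (Fin n)) :
    lap (lap f) x = ∑ i, ∑ j, pdList [j, j, i, i] f x := by
  rw [lap_eq hf.lap]
  refine Finset.sum_congr rfl fun i _ => ?_
  rw [lap_eq hf, pd_sum (fun j _ => (hf.pd j).pd j), pd_sum (fun j _ => ((hf.pd j).pd j).pd i)]
  rfl

/-- Moving a weight out of the bilaplacian costs lower-order terms. -/
lemma exists_bilaplacian_commutator_sq_le (hζ : IsCutoff ζ) {t : ℕ}
    (hw : IsWeight ζ (t + 4) w) : ∃ C ≥ 0, ∀ f, Smooth f → ∀ x,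
      (lap (lap (fun x => f x * w x)) x - w x * lap (lap f) x) ^ 2 ≤ C * lowSq ζ t 4 f x := by
  have h : ∀ i j : Fin n, _ := fun i j => exists_commutator_sq_le hζ [j, j, i, i] t hw
  choose C hC h using h
  refine ⟨n * ∑ i, n * ∑ j, C i j, mul_nonneg (by positivity) (Finset.sum_nonneg fun i _ =>
    mul_nonneg (by positivity) (Finset.sum_nonneg fun j _ => hC i j)), fun f hf x => ?_⟩
  rw [lap_lap_eq (hf.mul (hw.smooth hζ)), lap_lap_eq hf, Finset.mul_sum, ← Finset.sum_sub_distrib]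
  simp_rw [Finset.mul_sum (Finset.univ) _ (w x), ← Finset.sum_sub_distrib]
  refine (sq_sum_le_card_mul_sum_sq).trans ?_
  rw [Finset.card_univ, Fintype.card_fin, mul_assoc, Finset.sum_mul]
  gcongr with i
  refine (sq_sum_le_card_mul_sum_sq).trans ?_
  rw [Finset.card_univ, Fintype.card_fin, mul_assoc, Finset.sum_mul]
  gcongr with j
  exact h i j f hf x

end Commutator

section Estimates

variable {ζ f w : EuclideanSpace ℝ (Fin n) → ℝ}

lemma abs_mul_le_of_sq_le {g e a K Q ε : ℝ} (ha : 0 ≤ a) (hK : 0 ≤ K) (hQ : 0 ≤ Q) (hε : 0 < ε)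
    (h : e ^ 2 ≤ K * (a * Q)) : |g * e| ≤ ε * (a * g ^ 2) + K / (4 * ε) * Q := by
  apply abs_le_of_sq_le_sq _ (by positivity)
  have h1 : (g * e) ^ 2 ≤ g ^ 2 * (K * (a * Q)) := by
    rw [mul_pow]; exact mul_le_mul_of_nonneg_left h (sq_nonneg _)
  have h2 : g ^ 2 * (K * (a * Q)) = 4 * (ε * (a * g ^ 2)) * (K / (4 * ε) * Q) := by
    field_simp
  nlinarith [sq_nonneg (ε * (a * g ^ 2) - K / (4 * ε) * Q)]

lemma integrable_lowSq (hζ : IsCutoff ζ) {t : ℕ} (ht : t ≠ 0) (r : ℕ) (hf : Smooth f) :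
    Integrable (lowSq ζ t r f) :=
  integrable_finsetSum _ fun k _ => hζ.integrable (by omega) (hf.gradSq k).continuous

lemma integral_lowSq (hζ : IsCutoff ζ) {t : ℕ} (ht : t ≠ 0) (r : ℕ) (hf : Smooth f) :
    ∫ x, lowSq ζ t r f x = ∑ k ∈ Finset.range r, gradInt ζ t k f :=
  integral_finsetSum _ fun k _ => hζ.integrable (by omega) (hf.gradSq k).continuous

lemma exists_const_mul_integral_lowSq_le (hζ : IsCutoff ζ) {t : ℕ} (ht : t ≠ 0) {K ε : ℝ}
    (hK : 0 ≤ K) (hε : 0 < ε) : ∃ C ≥ 0, ∀ f, Smooth f → K * ∫ x, lowSq ζ t 4 f x ≤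
      ε * wInt ζ (t + 4) (fun x => lap (lap f) x ^ 2) + C * gradInt ζ t 0 f := by
  obtain ⟨C, hC, h⟩ := sum_gradInt_interp hζ ht (ε / (K + 1)) (by positivity)
  refine ⟨K * C, by positivity, fun f hf => ?_⟩
  rw [integral_lowSq hζ ht 4 hf]
  have a := mul_le_mul_of_nonneg_left (h f hf) hK
  have b : K * (ε / (K + 1) * wInt ζ (t + 4) (fun x => lap (lap f) x ^ 2)) ≤
      ε * wInt ζ (t + 4) (fun x => lap (lap f) x ^ 2) := by
    rw [← mul_assoc]
    refine mul_le_mul_of_nonneg_right ?_ (wInt_nonneg hζ _ fun x => sq_nonneg _)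
    rw [mul_div_assoc', div_le_iff₀ (by positivity)]
    linarith
  simp only [] at a
  linarith

/-- The energy of a cut-off function. -/
lemma exists_integral_bilaplacian_cutoff_sq_le (hζ : IsCutoff ζ) {t : ℕ} (ht : t ≠ 0) {ε : ℝ}
    (hε : 0 < ε) : ∃ C ≥ 0, ∀ f, Smooth f →
      ∫ x, lap (lap (fun x => f x * ζ x ^ (t + 4))) x ^ 2 ≤
        (1 + ε) * wInt ζ (t + 4) (fun x => lap (lap f) x ^ 2) + C * gradInt ζ t 0 f := by
  obtain ⟨K, hK, hE⟩ := exists_bilaplacian_commutator_sq_le hζ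
    (hζ.isWeight_pow (s := t + 4) (by omega))
  obtain ⟨C, hC, h⟩ := exists_const_mul_integral_lowSq_le hζ ht
    (K := (1 + 2 / ε) * K) (ε := ε / 2) (by positivity) (by positivity)
  refine ⟨C, hC, fun f hf => ?_⟩
  have i1 := (hζ.integrable (k := 2 * (t + 4)) (by omega)
    (hf.lap.lap.pow 2).continuous).const_mul (1 + ε / 2)
  have i2 := (integrable_lowSq hζ ht 4 hf).const_mul ((1 + 2 / ε) * K)
  have hs : Smooth (fun x => f x * ζ x ^ (t + 4)) := hf.mul (hζ.smooth.pow _)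
  have hc : HasCompactSupport (fun x => f x * ζ x ^ (t + 4)) :=
    (hζ.pow_hasCompactSupport (by omega)).mul_left
  have i0 : Integrable (fun x => lap (lap (fun x => f x * ζ x ^ (t + 4))) x ^ 2) := by
    simp only [sq]
    exact hs.lap.lap.integrable_mul hs.lap.lap
      (hasCompactSupport_lap (hasCompactSupport_lap hc hs) hs.lap)
  have key : ∀ x, lap (lap (fun x => f x * ζ x ^ (t + 4))) x ^ 2 ≤
      (1 + ε / 2) * (ζ x ^ (2 * (t + 4)) * lap (lap f) x ^ 2)
        + (1 + 2 / ε) * K * lowSq ζ t 4 f x := by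
    intro x
    have h1 := mul_le_mul_of_nonneg_left (hE f hf x) (show 0 ≤ 1 + 2 / ε by positivity)
    generalize lap (lap (fun x => f x * ζ x ^ (t + 4))) x = a at h1
    generalize lap (lap f) x = b at h1
    rw [show ζ x ^ (2 * (t + 4)) * b ^ 2 = (ζ x ^ (t + 4) * b) ^ 2 by ring]
    generalize ζ x ^ (t + 4) * b = c at h1
    have h2 : (1 + ε / 2) * c ^ 2 + (1 + 2 / ε) * (a - c) ^ 2 - a ^ 2
      = 2 / ε * ((a - c) - ε / 2 * c) ^ 2 := by
      field_simp; ring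
    have : 0 ≤ 2 / ε * ((a - c) - ε / 2 * c) ^ 2 := by positivity
    linarith
  have := integral_mono i0 (i1.add i2) key
  simp only [Pi.add_apply] at this
  rw [integral_add i1 i2, integral_const_mul, integral_const_mul] at this
  have h' := h f hf
  unfold wInt at h' ⊢
  linarith

/-- The energy identity up to lower-order terms. -/
lemma exists_abs_energy_sub_le (hζ : IsCutoff ζ) {t : ℕ} (ht : t ≠ 0) {ε : ℝ}
    (hε : 0 < ε) : ∃ C ≥ 0, ∀ f, Smooth f →
      |(∫ x, lap (lap f) x * lap (lap (fun x => f x * ζ x ^ (2 * (t + 4)))) x)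
        - wInt ζ (t + 4) (fun x => lap (lap f) x ^ 2)| ≤
      ε * wInt ζ (t + 4) (fun x => lap (lap f) x ^ 2) + C * gradInt ζ t 0 f := by
  obtain ⟨K, hK, hE⟩ := exists_bilaplacian_commutator_sq_le hζ (t := (t + 4) + t)
    (w := fun x => ζ x ^ (2 * (t + 4)))
    (by convert hζ.isWeight_pow (s := 2 * (t + 4)) (by omega) using 1; ring)
  obtain ⟨C, hC, h⟩ := exists_const_mul_integral_lowSq_le hζ ht
    (K := K / (4 * (ε / 2))) (ε := ε / 2) (by positivity) (by positivity)
  refine ⟨C, hC, fun f hf => ?_⟩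
  have hw : Smooth (fun x => ζ x ^ (2 * (t + 4))) := hζ.smooth.pow _
  have hs : Smooth (fun x => f x * ζ x ^ (2 * (t + 4))) := hf.mul hw
  have hc : HasCompactSupport (fun x => f x * ζ x ^ (2 * (t + 4))) :=
    (hζ.pow_hasCompactSupport (by omega)).mul_left
  have i1 := hζ.integrable (k := 2 * (t + 4)) (by omega) (hf.lap.lap.pow 2).continuous
  have i2 := (integrable_lowSq hζ ht 4 hf).const_mul (K / (4 * (ε / 2)))
  have i0 := hf.lap.lap.integrable_mul hs.lap.lap
      (hasCompactSupport_lap (hasCompactSupport_lap hc hs) hs.lap)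
  rw [wInt, ← integral_sub i0 i1]
  have key : ∀ x, ‖lap (lap f) x * lap (lap (fun x => f x * ζ x ^ (2 * (t + 4)))) x
      - ζ x ^ (2 * (t + 4)) * lap (lap f) x ^ 2‖ ≤
      ε / 2 * (ζ x ^ (2 * (t + 4)) * lap (lap f) x ^ 2)
        + K / (4 * (ε / 2)) * lowSq ζ t 4 f x := by
    intro x
    have h1 := hE f hf x
    rw [pow_mul_lowSq] at h1
    have := abs_mul_le_of_sq_le (g := lap (lap f) x) (pow_nonneg (hζ.nonneg x) _) hK
      (lowSq_nonneg hζ t 4 f x) (half_pos hε) h1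
    rw [Real.norm_eq_abs]
    convert this using 2
    ring
  have := norm_integral_le_of_norm_le ((i1.const_mul (ε / 2)).add i2)
    (Filter.Eventually.of_forall key)
  rw [Real.norm_eq_abs] at this
  refine this.trans ?_
  simp only [Pi.add_apply]
  rw [integral_add (i1.const_mul (ε / 2)) i2, integral_const_mul, integral_const_mul]
  have h' := h f hf
  unfold wInt at h'
  linarith

/-- The closed annulus between the spheres of radius one and two. -/
def annulus (n : ℕ) : Set (EuclideanSpace ℝ (Fin n)) := {x | 1 ≤ ‖x‖ ∧ ‖x‖ ≤ 2}

lemma isCompact_annulus : IsCompact (annulus n) := by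
  refine (isCompact_closedBall (0 : EuclideanSpace ℝ (Fin n)) 2).of_isClosed_subset ?_ ?_
  · exact (isClosed_le continuous_const continuous_norm).inter
      (isClosed_le continuous_norm continuous_const)
  · intro x hx; simpa using hx.2

lemma integral_weight_euler {G : EuclideanSpace ℝ (Fin n) → ℝ} (hG : ContDiff ℝ 1 G)
    (hw : Smooth w) (hc : HasCompactSupport w) :
    ∫ x, w x * ∑ j, x j * pd j G x = - ∫ x, G x * (n * w x + ∑ j, x j * pd j w x) := by
  have hdG : ∀ j, Continuous (pd j G) := fun j =>
    (hG.continuous_fderiv (by simp)).clm_apply continuous_const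
  have hj : ∀ j : Fin n, ∫ x, w x * (x j * pd j G x) = - ∫ x, G x * (w x + x j * pd j w x) := by
    intro j
    have hq : Smooth (fun x => x j * w x) := (Smooth.coord j).mul hw
    have hqc : HasCompactSupport (fun x => x j * w x) := hc.mul_left
    have h0 := integral_pd_eq_zero (f := fun x => G x * (x j * w x))
      (hG.mul (hq.of_le (by exact_mod_cast le_top))) hqc.mul_left j
    have e : pd j (fun x => G x * (x j * w x))
        = fun x => w x * (x j * pd j G x) + G x * (w x + x j * pd j w x) := by
      funext x
      rw [pd_mul_apply (hG.differentiable (by simp) x) (hq.differentiable x),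
        pd_mul (Smooth.coord j) hw, pd_coord]
      simp only [if_true]
      ring
    rw [e, integral_add] at h0
    · linarith
    · exact (hw.continuous.mul ((Smooth.coord j).continuous.mul (hdG j))
        ).integrable_of_hasCompactSupport hc.mul_right
    · exact (hG.continuous.mul (hw.continuous.add ((Smooth.coord j).continuous.mul
        (hw.pd j).continuous))).integrable_of_hasCompactSupport
        (hc.add (hasCompactSupport_pd hc j).mul_left).mul_left
  have e2 : ∀ x, G x * (n * w x + ∑ j, x j * pd j w x) = ∑ j, G x * (w x + x j * pd j w x) := by
    intro x
    rw [← Finset.mul_sum, Finset.sum_add_distrib]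
    simp
  simp_rw [e2, Finset.mul_sum]
  rw [integral_finsetSum, integral_finsetSum, Finset.sum_congr rfl fun j _ => hj j,
    Finset.sum_neg_distrib]
  · intro j _
    exact (hG.continuous.mul (hw.continuous.add ((Smooth.coord j).continuous.mul
        (hw.pd j).continuous))).integrable_of_hasCompactSupport
        (hc.add (hasCompactSupport_pd hc j).mul_left).mul_left
  · intro j _
    exact (hw.continuous.mul ((Smooth.coord j).continuous.mul (hdG j))
        ).integrable_of_hasCompactSupport hc.mul_right

lemma exists_euler_pow_le (hζ : IsCutoff ζ) {s : ℕ} (hs : s ≠ 0) : ∃ C ≥ 0, ∀ x,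
    |∑ j, x j * pd j (fun x => ζ x ^ s) x| ≤ (annulus n).indicator (fun _ => C) x := by
  have hw : Smooth (fun x => ζ x ^ s) := hζ.smooth.pow s
  obtain ⟨C, hC⟩ := isCompact_annulus.exists_bound_of_continuousOn
    (f := fun x => ∑ j, x j * pd j (fun x => ζ x ^ s) x) hw.euler.continuous.continuousOn
  refine ⟨|C|, abs_nonneg _, fun x => ?_⟩
  by_cases hx : x ∈ annulus n
  · rw [Set.indicator_of_mem hx]
    exact (hC x hx).trans (le_abs_self C)
  · rw [Set.indicator_of_notMem hx]
    have h0 : ∀ j, pd j (fun x => ζ x ^ s) x = 0 := by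
      intro j
      simp only [annulus, Set.mem_ofPred_eq, not_and_or, not_le] at hx
      rcases hx with hx | hx
      · rw [pd_congr (s := Metric.ball 0 1) (g := fun _ => 1) Metric.isOpen_ball _ j
          (by simpa using hx), pd_const]
        intro y hy
        simp [hζ.eq_one y (by simpa using (Metric.mem_ball.1 hy).le)]
      · rw [pd_congr (s := (Metric.closedBall 0 2)ᶜ) (g := fun _ => 0)
          Metric.isClosed_closedBall.isOpen_compl _ j (by simpa using hx), pd_const]
        intro y hy
        simp only [Set.mem_compl_iff, Metric.mem_closedBall, dist_zero_right, not_le] at hy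
        simp [hζ.eq_zero y hy.le, hs]
    simp [h0]

end Estimates

section Pohozaev

variable {ζ f w : EuclideanSpace ℝ (Fin n) → ℝ}

lemma lap_lap_sq_le (hf : Smooth f) (x : EuclideanSpace ℝ (Fin n)) :
    lap (lap f) x ^ 2 ≤ n ^ 2 * gradSq 4 f x := by
  have h1 := lap_sq_le hf.lap x
  have h2 := mul_le_mul_of_nonneg_left (gradSq_lap_le hf 2 x) (Nat.cast_nonneg (α := ℝ) n)
  linarith

lemma exists_euler_commutator_sq_le_lowSq (hζ : IsCutoff ζ) (t : ℕ) :
    ∃ C ≥ 0, ∀ f, Smooth f → ∀ x,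
      (lap (lap (fun x => (∑ j, x j * pd j f x) * ζ x ^ (2 * (t + 5)))) x
        - ζ x ^ (2 * (t + 5)) * ((∑ j, x j * pd j (lap (lap f)) x) + 4 * lap (lap f) x)) ^ 2
        ≤ C * lowSq ζ t 5 f x := by
  have hw : ∀ j : Fin n, IsWeight ζ ((2 * t + 6) + 4) (fun x => x j * ζ x ^ (2 * (t + 5))) := by
    intro j
    have := (hζ.isWeight_pow (s := 2 * (t + 5)) (by omega)).smooth_mul (Smooth.coord j)
    convert this using 1
    ring
  choose C hC h using fun j => exists_bilaplacian_commutator_sq_le hζ (hw j)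
  refine ⟨2 * (n * ∑ j, C j) + 32 * n ^ 2, add_nonneg (mul_nonneg zero_le_two
    (mul_nonneg (Nat.cast_nonneg n) (Finset.sum_nonneg fun j _ => hC j))) (by positivity),
    fun f hf x => ?_⟩
  have hsm : ∀ j, Smooth (fun x => pd j f x * (x j * ζ x ^ (2 * (t + 5)))) := fun j =>
    (hf.pd j).mul ((hw j).smooth hζ)
  have e1 : (fun x => (∑ j, x j * pd j f x) * ζ x ^ (2 * (t + 5)))
      = fun x => ∑ j, pd j f x * (x j * ζ x ^ (2 * (t + 5))) := by
    funext x
    rw [Finset.sum_mul]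
    exact Finset.sum_congr rfl fun j _ => by ring
  have e2 : lap (lap (fun x => (∑ j, x j * pd j f x) * ζ x ^ (2 * (t + 5)))) x
      - ζ x ^ (2 * (t + 5)) * ((∑ j, x j * pd j (lap (lap f)) x) + 4 * lap (lap f) x)
      = (∑ j, (lap (lap (fun x => pd j f x * (x j * ζ x ^ (2 * (t + 5))))) x
        - (x j * ζ x ^ (2 * (t + 5))) * lap (lap (pd j f)) x))
        - 4 * (ζ x ^ (2 * (t + 5)) * lap (lap f) x) := by
    rw [e1, lap_sum fun j _ => hsm j, lap_sum fun j _ => (hsm j).lap, Finset.sum_sub_distrib,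
      mul_add (ζ x ^ (2 * (t + 5))), Finset.mul_sum]
    have : ∀ j, (x j * ζ x ^ (2 * (t + 5))) * lap (lap (pd j f)) x
        = ζ x ^ (2 * (t + 5)) * (x j * pd j (lap (lap f)) x) := by
      intro j
      rw [pd_lap hf.lap, pd_lap hf]; ring
    simp only [this]
    ring
  rw [e2]
  set S := ∑ j, (lap (lap (fun x => pd j f x * (x j * ζ x ^ (2 * (t + 5))))) x
        - (x j * ζ x ^ (2 * (t + 5))) * lap (lap (pd j f)) x) with hS
  have b1 : S ^ 2 ≤ n * ∑ j, C j * lowSq ζ t 5 f x := by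
    refine (sq_sum_le_card_mul_sum_sq (s := Finset.univ)).trans ?_
    simp only [Finset.card_univ, Fintype.card_fin]
    refine mul_le_mul_of_nonneg_left (Finset.sum_le_sum fun j _ => ?_) (Nat.cast_nonneg n)
    refine (h j (pd j f) (hf.pd j) x).trans (mul_le_mul_of_nonneg_left ?_ (hC j))
    exact (lowSq_anti hζ (by omega) 4 (pd j f) x).trans (lowSq_pd_le hζ t 4 f j x)
  have b2 : (ζ x ^ (2 * (t + 5)) * lap (lap f) x) ^ 2 ≤ n ^ 2 * lowSq ζ t 5 f x := by
    rw [mul_pow, ← pow_mul]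
    have h1 : ζ x ^ (2 * (t + 5) * 2) ≤ ζ x ^ (2 * (t + 4)) :=
      pow_le_pow_of_le_one (hζ.nonneg x) (hζ.le_one x) (by omega)
    have h2 : ζ x ^ (2 * (t + 4)) * gradSq 4 f x ≤ lowSq ζ t 5 f x :=
      Finset.single_le_sum (f := fun k => ζ x ^ (2 * (t + k)) * gradSq k f x)
        (fun k _ => mul_nonneg (pow_nonneg (hζ.nonneg x) _) (gradSq_nonneg _ _ _))
        (Finset.mem_range.2 (by norm_num))
    calc ζ x ^ (2 * (t + 5) * 2) * lap (lap f) x ^ 2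
        ≤ ζ x ^ (2 * (t + 4)) * (n ^ 2 * gradSq 4 f x) :=
          mul_le_mul h1 (lap_lap_sq_le hf x) (sq_nonneg _) (pow_nonneg (hζ.nonneg x) _)
      _ = n ^ 2 * (ζ x ^ (2 * (t + 4)) * gradSq 4 f x) := by ring
      _ ≤ n ^ 2 * lowSq ζ t 5 f x := by gcongr
  rw [← Finset.sum_mul] at b1
  nlinarith [sq_nonneg (S + 4 * (ζ x ^ (2 * (t + 5)) * lap (lap f) x))]

lemma exists_euler_commutator_sq_le (hζ : IsCutoff ζ) {t : ℕ} (ht : t ≠ 0) :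
    ∃ C ≥ 0, ∀ f, Smooth f → ∀ x,
      (lap (lap (fun x => (∑ j, x j * pd j f x) * ζ x ^ (2 * (t + 5)))) x
        - ζ x ^ (2 * (t + 5)) * ((∑ j, x j * pd j (lap (lap f)) x) + 4 * lap (lap f) x)) ^ 2
        ≤ C * ((annulus n).indicator 1 x * lowSq ζ t 5 f x) := by
  obtain ⟨C, hC, h⟩ := exists_euler_commutator_sq_le_lowSq hζ t
  refine ⟨C, hC, fun f hf x => ?_⟩
  by_cases hx : x ∈ annulus n
  · simpa [Set.indicator_of_mem hx] using h f hf x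
  · rw [Set.indicator_of_notMem hx, zero_mul, mul_zero]
    simp only [annulus, Set.mem_ofPred_eq, not_and_or, not_le] at hx
    rcases hx with hx | hx
    · have hF : Smooth (fun x => ∑ j, x j * pd j f x) := hf.euler
      have hs : Smooth (fun x => (∑ j, x j * pd j f x) * ζ x ^ (2 * (t + 5))) :=
        hF.mul (hζ.smooth.pow _)
      have h1 : Set.EqOn (fun x => (∑ j, x j * pd j f x) * ζ x ^ (2 * (t + 5)))
          (fun x => ∑ j, x j * pd j f x) (Metric.ball 0 1) := by
        intro y hy
        simp [hζ.eq_one y (by simpa using (Metric.mem_ball.1 hy).le)]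
      have h2 := lap_congr Metric.isOpen_ball (lap_congr Metric.isOpen_ball h1 hs hF) hs.lap hF.lap
      rw [h2 (by simpa using hx), lap_lap_euler hf, hζ.eq_one x hx.le]
      simp
    · have h0 : lowSq ζ t 5 f x = 0 := Finset.sum_eq_zero fun k _ => by
        rw [hζ.eq_zero x hx.le, zero_pow (by omega), zero_mul]
      simpa only [h0, mul_zero] using h f hf x

lemma measurableSet_annulus : MeasurableSet (annulus n) :=
  isCompact_annulus.isClosed.measurableSet

lemma integrableOn_annulus {F : EuclideanSpace ℝ (Fin n) → ℝ} (hF : Continuous F) :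
    IntegrableOn F (annulus n) :=
  hF.continuousOn.integrableOn_compact isCompact_annulus

lemma abs_integral_mul_le_annulus {F g : EuclideanSpace ℝ (Fin n) → ℝ} {C : ℝ}
    (hF : Continuous F) (hF0 : ∀ x, 0 ≤ F x)
    (hg : ∀ x, |g x| ≤ (annulus n).indicator (fun _ => C) x) :
    |∫ x, F x * g x| ≤ C * ∫ x in annulus n, F x := by
  rw [← integral_indicator measurableSet_annulus, ← integral_const_mul, ← Real.norm_eq_abs]
  refine norm_integral_le_of_norm_le
    (((integrable_indicator_iff measurableSet_annulus).2 (integrableOn_annulus hF)).const_mul C)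
    (Filter.Eventually.of_forall fun x => ?_)
  rw [Real.norm_eq_abs, abs_mul, abs_of_nonneg (hF0 x)]
  refine (mul_le_mul_of_nonneg_left (hg x) (hF0 x)).trans_eq ?_
  by_cases hx : x ∈ annulus n <;> simp [hx, mul_comm]

/-- The bilinear Pohozaev identity, up to terms on the annulus and lower-order terms. -/
lemma exists_abs_pohozaev_sub_le (hζ : IsCutoff ζ) {t : ℕ} (ht : t ≠ 0) {ε : ℝ} (hε : 0 < ε) :
    ∃ C ≥ 0, ∀ f, Smooth f →
      |(∫ x, lap (lap f) x
          * lap (lap (fun x => (∑ j, x j * pd j f x) * ζ x ^ (2 * (t + 5)))) x)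
        - (4 - n / 2) * wInt ζ (t + 5) (fun x => lap (lap f) x ^ 2)| ≤
      ε * (wInt ζ (t + 4) (fun x => lap (lap f) x ^ 2) + gradInt ζ t 0 f)
        + C * ∫ x in annulus n, lap (lap f) x ^ 2 := by
  obtain ⟨K, hK, hE⟩ := exists_euler_commutator_sq_le hζ ht
  obtain ⟨C₁, hC₁, h1⟩ := sum_gradInt_interp hζ ht 1 one_pos
  obtain ⟨C₂, hC₂, h2⟩ := gradInt_four_le_bilaplacian hζ ht
  obtain ⟨C₃, hC₃, h3⟩ := exists_euler_pow_le hζ (s := 2 * (t + 5)) (by omega)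
  set D := K * (1 + C₁ + C₂) / (4 * ε) + 1 with hD
  have hD0 : 0 < D := by positivity
  refine ⟨D + C₃ / 2, by positivity, fun f hf => ?_⟩
  have hw : Smooth (fun x => ζ x ^ (2 * (t + 5))) := hζ.smooth.pow _
  have hwc : HasCompactSupport (fun x => ζ x ^ (2 * (t + 5))) :=
    hζ.pow_hasCompactSupport (by omega)
  have hs : Smooth (fun x => (∑ j, x j * pd j f x) * ζ x ^ (2 * (t + 5))) := hf.euler.mul hw
  have hc : HasCompactSupport (fun x => (∑ j, x j * pd j f x) * ζ x ^ (2 * (t + 5))) :=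
    hwc.mul_left
  have hL : Smooth (lap (lap f)) := hf.lap.lap
  set E : EuclideanSpace ℝ (Fin n) → ℝ := fun x =>
    lap (lap (fun x => (∑ j, x j * pd j f x) * ζ x ^ (2 * (t + 5)))) x
        - ζ x ^ (2 * (t + 5)) * ((∑ j, x j * pd j (lap (lap f)) x) + 4 * lap (lap f) x) with hEdef
  have iE : Integrable (fun x => lap (lap f) x * E x) := by
    refine hL.integrable_mul (hs.lap.lap.sub (hw.mul (hL.euler.add ((Smooth.const 4).mul hL)))) ?_
    exact (hasCompactSupport_lap (hasCompactSupport_lap hc hs) hs.lap).sub hwc.mul_right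
  have i1 : Integrable (fun x => ζ x ^ (2 * (t + 5)) * lap (lap f) x ^ 2) :=
    hζ.integrable (by omega) (hL.pow 2).continuous
  have i2 : Integrable (fun x => ζ x ^ (2 * (t + 5)) *
      ∑ j, x j * pd j (fun x => lap (lap f) x ^ 2) x) :=
    hζ.integrable (by omega) (hL.pow 2).euler.continuous
  have hsplit : ∀ x, lap (lap f) x
          * lap (lap (fun x => (∑ j, x j * pd j f x) * ζ x ^ (2 * (t + 5)))) x
      = lap (lap f) x * E x + (1 / 2 * (ζ x ^ (2 * (t + 5)) *
      ∑ j, x j * pd j (fun x => lap (lap f) x ^ 2) x)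
        + 4 * (ζ x ^ (2 * (t + 5)) * lap (lap f) x ^ 2)) := by
    intro x
    have : ∑ j, x j * pd j (fun x => lap (lap f) x ^ 2) x
        = 2 * lap (lap f) x * ∑ j, x j * pd j (lap (lap f)) x := by
      rw [Finset.mul_sum]
      refine Finset.sum_congr rfl fun j _ => ?_
      rw [pd_pow hL]
      simp; ring
    rw [this, hEdef]
    ring
  have hint : ∫ x, lap (lap f) x
          * lap (lap (fun x => (∑ j, x j * pd j f x) * ζ x ^ (2 * (t + 5)))) x
      = (∫ x, lap (lap f) x * E x) + (4 - n / 2) * wInt ζ (t + 5) (fun x => lap (lap f) x ^ 2)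
        - 1 / 2 * ∫ x, lap (lap f) x ^ 2 * ∑ j, x j * pd j (fun x => ζ x ^ (2 * (t + 5))) x := by
    have i3 : Integrable (fun x => 1 / 2 * (ζ x ^ (2 * (t + 5)) *
        ∑ j, x j * pd j (fun x => lap (lap f) x ^ 2) x)
        + 4 * (ζ x ^ (2 * (t + 5)) * lap (lap f) x ^ 2)) := (i2.const_mul _).add (i1.const_mul _)
    simp_rw [hsplit]
    rw [integral_add iE i3, integral_add (i2.const_mul _) (i1.const_mul _), integral_const_mul, integral_const_mul,
      integral_weight_euler ((hL.pow 2).of_le (by exact_mod_cast le_top)) hw hwc]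
    have e : ∀ x, lap (lap f) x ^ 2 * (n * ζ x ^ (2 * (t + 5))
        + ∑ j, x j * pd j (fun x => ζ x ^ (2 * (t + 5))) x)
        = n * (ζ x ^ (2 * (t + 5)) * lap (lap f) x ^ 2) +
          lap (lap f) x ^ 2 * ∑ j, x j * pd j (fun x => ζ x ^ (2 * (t + 5))) x := fun x => by ring
    simp_rw [e]
    rw [integral_add (i1.const_mul _), integral_const_mul, wInt]
    · ring
    · refine (hL.pow 2).integrable_mul hw.euler ?_
      refine HasCompactSupport.intro (isCompact_annulus (n := n)) fun x hx => ?_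
      have := h3 x
      rw [Set.indicator_of_notMem hx] at this
      exact abs_nonpos_iff.1 this
  have bE : |∫ x, lap (lap f) x * E x| ≤ D * (∫ x in annulus n, lap (lap f) x ^ 2)
      + K / (4 * D) * ∫ x, lowSq ζ t 5 f x := by
    rw [← integral_indicator measurableSet_annulus, ← integral_const_mul, ← integral_const_mul,
      ← integral_add, ← Real.norm_eq_abs]
    · refine norm_integral_le_of_norm_le ?_ (Filter.Eventually.of_forall fun x => ?_)
      · exact (((integrable_indicator_iff measurableSet_annulus).2
          (integrableOn_annulus (hL.pow 2).continuous)).const_mul D).add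
          ((integrable_lowSq hζ ht 5 hf).const_mul _)
      · have := abs_mul_le_of_sq_le (g := lap (lap f) x)
          (Set.indicator_nonneg (fun _ _ => zero_le_one) x) hK
          (lowSq_nonneg hζ t 5 f x) hD0 (hE f hf x)
        rw [Real.norm_eq_abs]
        convert this using 3
        by_cases hx : x ∈ annulus n <;> simp [hx]
    · exact ((integrable_indicator_iff measurableSet_annulus).2
          (integrableOn_annulus (hL.pow 2).continuous)).const_mul D
    · exact (integrable_lowSq hζ ht 5 hf).const_mul _
  have bl : ∫ x, lowSq ζ t 5 f x ≤
      (1 + C₁ + C₂) * (wInt ζ (t + 4) (fun x => lap (lap f) x ^ 2) + gradInt ζ t 0 f) := by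
    rw [integral_lowSq hζ ht 5 hf, Finset.sum_range_succ]
    have a1 := h1 f hf
    have a2 := h2 f hf
    have p1 : 0 ≤ wInt ζ (t + 4) (fun x => lap (lap f) x ^ 2) :=
      wInt_nonneg hζ _ fun x => sq_nonneg _
    have p2 := gradInt_nonneg hζ t 0 f
    simp only [] at a1
    nlinarith [mul_nonneg hC₁ p1]
  have bl' : K / (4 * D) * ∫ x, lowSq ζ t 5 f x ≤
      ε * (wInt ζ (t + 4) (fun x => lap (lap f) x ^ 2) + gradInt ζ t 0 f) := by
    refine (mul_le_mul_of_nonneg_left bl (by positivity)).trans ?_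
    rw [← mul_assoc]
    refine mul_le_mul_of_nonneg_right ?_
      (add_nonneg (wInt_nonneg hζ _ fun x => sq_nonneg _) (gradInt_nonneg hζ t 0 f))
    rw [div_mul_eq_mul_div, div_le_iff₀ (by positivity), hD]
    have : ε * (4 * (K * (1 + C₁ + C₂) / (4 * ε) + 1)) = K * (1 + C₁ + C₂) + 4 * ε := by
      field_simp
    linarith
  have b3 := abs_integral_mul_le_annulus (F := fun x => lap (lap f) x ^ 2) (hL.pow 2).continuous
    (fun x => sq_nonneg _) h3
  rw [hint]
  rw [abs_le] at bE b3 ⊢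
  constructor <;> nlinarith [bE.1, bE.2, b3.1, b3.2]

end Pohozaev

section Solutions

variable {ζ v : EuclideanSpace ℝ (Fin n) → ℝ} {p : ℝ}

lemma abs_rpow_mul_self_mul_self (hp : 1 < p) (r : ℝ) :
    |r| ^ (p - 1) * r * r = |r| ^ (p + 1) := by
  rcases eq_or_ne r 0 with rfl | hr
  · rw [abs_zero, zero_rpow (by linarith : p + 1 ≠ 0)]; simp
  · rw [mul_assoc, ← abs_mul_abs_self r, ← sq, ← rpow_natCast, ← rpow_add (abs_pos.2 hr)]
    congr 1; push_cast; ring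

lemma contDiff_abs_rpow (hp : 1 < p) : ContDiff ℝ 1 (fun r : ℝ => |r| ^ (p + 1)) := by
  simpa [Real.norm_eq_abs] using contDiff_norm_rpow (E := ℝ) (p := p + 1) (by linarith)

lemma pd_abs_rpow (hp : 1 < p) (hv : Smooth v) (j : Fin n) (x : EuclideanSpace ℝ (Fin n)) :
    pd j (fun x => |v x| ^ (p + 1)) x = (p + 1) * (|v x| ^ (p - 1) * v x * pd j v x) := by
  have h := (hasDerivAt_abs_rpow (v x) (p := p + 1) (by linarith)).comp_hasFDerivAt x
    (hv.differentiable x).hasFDerivAt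
  simp only [pd]
  rw [show (fun x => |v x| ^ (p + 1)) = (fun r => |r| ^ (p + 1)) ∘ v from rfl, h.fderiv]
  simp only [smul_apply, smul_eq_mul]
  rw [show p + 1 - 2 = p - 1 by ring]
  ring

lemma Smooth.continuous_abs_rpow (hp : 1 < p) (hv : Smooth v) :
    Continuous (fun x => |v x| ^ (p + 1)) :=
  (contDiff_abs_rpow hp).continuous.comp hv.continuous

/-- The energy identity for solutions. -/
lemma exists_abs_energy_solution_le (hζ : IsCutoff ζ) {t : ℕ} (ht : t ≠ 0) {ε : ℝ}
    (hε : 0 < ε) (hp : 1 < p) : ∃ C ≥ 0, ∀ (l : ℝ) (v), Smooth v →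
      (∀ x, lap^[4] v x = l * (|v x| ^ (p - 1) * v x)) →
      |l * wInt ζ (t + 4) (fun x => |v x| ^ (p + 1))
        - wInt ζ (t + 4) (fun x => lap (lap v) x ^ 2)| ≤
      ε * wInt ζ (t + 4) (fun x => lap (lap v) x ^ 2) + C * gradInt ζ t 0 v := by
  obtain ⟨C, hC, h⟩ := exists_abs_energy_sub_le hζ ht hε
  refine ⟨C, hC, fun l v hv heq => ?_⟩
  have h1 := h v hv
  rw [← integral_lap_four_mul hv (hv.mul (hζ.smooth.pow _))
    (hζ.pow_hasCompactSupport (by omega)).mul_left] at h1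
  convert h1 using 3
  rw [wInt, ← integral_const_mul]
  congr 1; funext x
  rw [heq, ← abs_rpow_mul_self_mul_self hp]
  ring

/-- The Pohozaev identity for solutions. -/
lemma exists_abs_pohozaev_solution_le (hζ : IsCutoff ζ) {t : ℕ} (ht : t ≠ 0) {ε : ℝ}
    (hε : 0 < ε) (hp : 1 < p) : ∃ C ≥ 0, ∀ (l : ℝ) (v), 0 ≤ l → Smooth v →
      (∀ x, lap^[4] v x = l * (|v x| ^ (p - 1) * v x)) →
      |((n : ℝ) / 2 - 4) * wInt ζ (t + 5) (fun x => lap (lap v) x ^ 2)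
        - n / (p + 1) * (l * wInt ζ (t + 5) (fun x => |v x| ^ (p + 1)))| ≤
      ε * (wInt ζ (t + 4) (fun x => lap (lap v) x ^ 2) + gradInt ζ t 0 v)
        + C * ((∫ x in annulus n, lap (lap v) x ^ 2)
          + l * ∫ x in annulus n, |v x| ^ (p + 1)) := by
  obtain ⟨C, hC, h⟩ := exists_abs_pohozaev_sub_le hζ ht hε
  obtain ⟨C₃, hC₃, h3⟩ := exists_euler_pow_le hζ (s := 2 * (t + 5)) (by omega)
  refine ⟨C + C₃, by positivity, fun l v hl hv heq => ?_⟩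
  have h1 := h v hv
  have hw : Smooth (fun x => ζ x ^ (2 * (t + 5))) := hζ.smooth.pow _
  have hwc : HasCompactSupport (fun x => ζ x ^ (2 * (t + 5))) :=
    hζ.pow_hasCompactSupport (by omega)
  have hG : ContDiff ℝ 1 (fun x => |v x| ^ (p + 1)) :=
    (contDiff_abs_rpow hp).comp (hv.of_le (by exact_mod_cast le_top))
  have hGc : Continuous (fun x => |v x| ^ (p + 1)) := hG.continuous
  have hp0 : p + 1 ≠ 0 := by linarith
  have e1 : ∀ x, lap^[4] v x * ((∑ j, x j * pd j v x) * ζ x ^ (2 * (t + 5)))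
      = l / (p + 1) * (ζ x ^ (2 * (t + 5)) * ∑ j, x j * pd j (fun x => |v x| ^ (p + 1)) x) := by
    intro x
    have : ∑ j, x j * pd j (fun x => |v x| ^ (p + 1)) x
        = (p + 1) * (|v x| ^ (p - 1) * v x) * ∑ j, x j * pd j v x := by
      rw [Finset.mul_sum]
      refine Finset.sum_congr rfl fun j _ => ?_
      rw [pd_abs_rpow hp hv]; ring
    rw [this, heq]
    field_simp
  have e2 : ∀ x, |v x| ^ (p + 1) * (n * ζ x ^ (2 * (t + 5))
        + ∑ j, x j * pd j (fun x => ζ x ^ (2 * (t + 5))) x)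
        = n * (ζ x ^ (2 * (t + 5)) * |v x| ^ (p + 1)) +
          |v x| ^ (p + 1) * ∑ j, x j * pd j (fun x => ζ x ^ (2 * (t + 5))) x := fun x => by ring
  have i1 : Integrable (fun x => ζ x ^ (2 * (t + 5)) * |v x| ^ (p + 1)) :=
    hζ.integrable (by omega) hGc
  have i2 : Integrable (fun x => |v x| ^ (p + 1)
      * ∑ j, x j * pd j (fun x => ζ x ^ (2 * (t + 5))) x) := by
    refine (hGc.mul hw.euler.continuous).integrable_of_hasCompactSupport ?_
    refine HasCompactSupport.intro (isCompact_annulus (n := n)) fun x hx => ?_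
    have := h3 x
    rw [Set.indicator_of_notMem hx] at this
    simp [abs_nonpos_iff.1 this]
  rw [← integral_lap_four_mul hv (hv.euler.mul hw) hwc.mul_left] at h1
  simp_rw [e1] at h1
  rw [integral_const_mul, integral_weight_euler hG hw hwc] at h1
  simp_rw [e2] at h1
  rw [integral_add (i1.const_mul _) i2, integral_const_mul] at h1
  have b3 := abs_integral_mul_le_annulus hGc (fun x => rpow_nonneg (abs_nonneg (v x)) _) h3
  set I := ∫ x, |v x| ^ (p + 1) * ∑ j, x j * pd j (fun x => ζ x ^ (2 * (t + 5))) x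
  have b4 : |l / (p + 1) * I| ≤ C₃ * (l * ∫ x in annulus n, |v x| ^ (p + 1)) := by
    have hlp : |l / (p + 1)| ≤ l := by
      rw [abs_of_nonneg (by positivity)]
      exact div_le_self hl (by linarith)
    rw [abs_mul]
    calc _ ≤ l * (C₃ * ∫ x in annulus n, |v x| ^ (p + 1)) :=
          mul_le_mul hlp b3 (abs_nonneg _) hl
      _ = _ := by ring
  have p1 : 0 ≤ ∫ x in annulus n, lap (lap v) x ^ 2 := integral_nonneg fun x => sq_nonneg _
  have p2 : 0 ≤ ∫ x in annulus n, |v x| ^ (p + 1) :=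
    integral_nonneg fun x => rpow_nonneg (abs_nonneg (v x)) _
  have p3 := mul_nonneg hC (mul_nonneg hl p2)
  have p4 := mul_nonneg hC₃ p1
  have e5 : l / (p + 1) * -(n * (∫ x, ζ x ^ (2 * (t + 5)) * |v x| ^ (p + 1)) + I)
      = - (n / (p + 1) * (l * wInt ζ (t + 5) (fun x => |v x| ^ (p + 1)))) - l / (p + 1) * I := by
    rw [wInt]; field_simp; ring
  rw [e5] at h1
  rw [abs_le] at h1 b4 ⊢
  constructor <;> nlinarith [h1.1, h1.2, b4.1, b4.2]

lemma sq_le_of_young {t : ℕ} (ht : 8 ≤ t * (p - 1)) (hp : 1 < p) {z d r : ℝ} (hz : 0 < z)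
    (hz1 : z ≤ 1) (hd : 0 < d) :
    z ^ (2 * t) * r ^ 2 ≤ d * (z ^ (2 * (t + 4)) * |r| ^ (p + 1)) + d ^ (-2 / (p - 1)) := by
  have hd' : 0 ≤ d ^ (-2 / (p - 1)) := rpow_nonneg hd.le _
  have hr' : 0 ≤ |r| ^ (p + 1) := rpow_nonneg (abs_nonneg _) _
  by_cases h : r ^ 2 ≤ d * (z ^ 8 * |r| ^ (p + 1))
  · have := mul_le_mul_of_nonneg_left h (pow_nonneg hz.le (2 * t))
    have e : z ^ (2 * t) * (d * (z ^ 8 * |r| ^ (p + 1)))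
      = d * (z ^ (2 * (t + 4)) * |r| ^ (p + 1)) := by ring
    linarith
  · rw [not_le] at h
    have hr : 0 < |r| := by
      rw [abs_pos]; rintro rfl
      have : 0 ≤ d * (z ^ 8 * |(0 : ℝ)| ^ (p + 1)) := by positivity
      rw [sq, zero_mul] at h; linarith
    have e : |r| ^ (p + 1) = |r| ^ (p - 1) * r ^ 2 := by
      rw [← abs_rpow_mul_self_mul_self hp]; ring
    have hr2 : 0 < r ^ 2 := by rw [← sq_abs]; positivity
    have h1 : d * (z ^ 8 * |r| ^ (p - 1)) < 1 := by
      rw [e] at h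
      by_contra hcon
      rw [not_lt] at hcon
      nlinarith [mul_le_mul_of_nonneg_right hcon hr2.le]
    have h2 : (|r| * z ^ t) ^ (p - 1) ≤ d⁻¹ := by
      rw [mul_rpow hr.le (by positivity), ← rpow_natCast z t, ← rpow_mul hz.le]
      have : z ^ (t * (p - 1)) ≤ z ^ 8 := by
        rw [← rpow_natCast z 8]
        exact rpow_le_rpow_of_exponent_ge hz hz1 (by exact_mod_cast ht)
      rw [← one_div, le_div_iff₀ hd]
      have h3 : 0 ≤ |r| ^ (p - 1) := rpow_nonneg hr.le _
      have := mul_le_mul_of_nonneg_left this h3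
      nlinarith
    have h3 : z ^ (2 * t) * r ^ 2 = ((|r| * z ^ t) ^ (p - 1)) ^ (2 / (p - 1)) := by
      rw [← rpow_mul (by positivity), mul_div_cancel₀ _ (by linarith : p - 1 ≠ 0),
        show (2 : ℝ) = ((2 : ℕ) : ℝ) by norm_num, rpow_natCast, mul_pow, sq_abs]
      ring
    have h4 := rpow_le_rpow (by positivity) h2 (by
      have : 0 < p - 1 := by linarith
      positivity : 0 ≤ 2 / (p - 1))
    rw [inv_rpow hd.le, ← rpow_neg hd.le, ← neg_div] at h4
    have : 0 ≤ d * (z ^ (2 * (t + 4)) * |r| ^ (p + 1)) := by positivity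
    linarith

/-- Young's inequality for the zeroth-order term. -/
lemma gradInt_zero_le (hζ : IsCutoff ζ) {t : ℕ} (ht : 8 ≤ t * (p - 1)) (hp : 1 < p) {d : ℝ}
    (hd : 0 < d) (hv : Smooth v) : gradInt ζ t 0 v ≤
      d * wInt ζ (t + 4) (fun x => |v x| ^ (p + 1))
        + d ^ (-2 / (p - 1))
          * volume.real (Metric.closedBall (0 : EuclideanSpace ℝ (Fin n)) 2) := by
  have ht0 : t ≠ 0 := by rintro rfl; norm_num at ht
  have hm : MeasurableSet (Metric.closedBall (0 : EuclideanSpace ℝ (Fin n)) 2) :=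
    Metric.isClosed_closedBall.measurableSet
  have i1 : Integrable ((Metric.closedBall (0 : EuclideanSpace ℝ (Fin n)) 2).indicator
      (fun _ => d ^ (-2 / (p - 1)))) := by
    rw [integrable_indicator_iff hm]
    exact integrableOn_const (isCompact_closedBall _ _).measure_lt_top.ne
  have i2 : Integrable (fun x => ζ x ^ (2 * (t + 4)) * |v x| ^ (p + 1)) :=
    hζ.integrable (by omega) (hv.continuous_abs_rpow hp)
  have i3 : Integrable (fun x => ζ x ^ (2 * (t + 0)) * gradSq 0 v x) :=
    hζ.integrable (by omega) (hv.gradSq 0).continuous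
  have key : ∀ x, ζ x ^ (2 * (t + 0)) * gradSq 0 v x ≤
      d * (ζ x ^ (2 * (t + 4)) * |v x| ^ (p + 1))
        + (Metric.closedBall (0 : EuclideanSpace ℝ (Fin n)) 2).indicator
          (fun _ => d ^ (-2 / (p - 1))) x := by
    intro x
    by_cases hx : ζ x = 0
    · rw [hx, zero_pow (by omega), zero_pow (by omega)]
      have := Set.indicator_nonneg (s := Metric.closedBall (0 : EuclideanSpace ℝ (Fin n)) 2)
        (f := fun _ => d ^ (-2 / (p - 1))) (fun _ _ => rpow_nonneg hd.le _) x
      simpa using this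
    · rw [Set.indicator_of_mem]
      · exact sq_le_of_young ht hp (lt_of_le_of_ne (hζ.nonneg x) (Ne.symm hx)) (hζ.le_one x) hd
      · by_contra hcon
        exact hx (hζ.eq_zero x (by simpa using (not_le.1 (by simpa using hcon)).le))
  have := integral_mono i3 ((i2.const_mul d).add i1) key
  simp only [Pi.add_apply] at this
  rw [integral_add (i2.const_mul d) i1, integral_const_mul, integral_indicator_const _ hm,
    smul_eq_mul] at this
  rw [gradInt, wInt, wInt]
  linarith

end Solutions

section Scaling

variable {ζ f u : EuclideanSpace ℝ (Fin n) → ℝ} {p R : ℝ}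

lemma Smooth.comp_smul (hf : Smooth f) (R : ℝ) : Smooth (fun x => f (R • x)) :=
  ContDiff.comp hf (contDiff_const_smul R)

lemma pd_comp_smul (hf : Smooth f) (R : ℝ) (i : Fin n) :
    pd i (fun x => f (R • x)) = fun x => R * pd i f (R • x) := by
  funext x
  have h := (hf.differentiable (R • x)).hasFDerivAt.comp x
    ((hasFDerivAt_id (𝕜 := ℝ) x).const_smul R)
  change fderiv ℝ (f ∘ HSMul.hSMul R) x _ = _
  rw [h.fderiv]
  simp [pd]

lemma lap_comp_smul (hf : Smooth f) (R : ℝ) :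
    lap (fun x => f (R • x)) = fun x => R ^ 2 * lap f (R • x) := by
  rw [lap_eq hf, lap_eq (hf.comp_smul R)]
  funext x
  rw [Finset.mul_sum]
  refine Finset.sum_congr rfl fun i _ => ?_
  rw [pd_comp_smul hf, pd_const_mul ((hf.pd i).comp_smul R), pd_comp_smul (hf.pd i)]
  ring

lemma lap_lap_comp_smul (hf : Smooth f) (R : ℝ) :
    lap (lap (fun x => f (R • x))) = fun x => R ^ 4 * lap (lap f) (R • x) := by
  rw [lap_comp_smul hf, lap_const_mul (hf.lap.comp_smul R), lap_comp_smul hf.lap]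
  funext x; ring

lemma lap_four_comp_smul (hf : Smooth f) (R : ℝ) :
    lap^[4] (fun x => f (R • x)) = fun x => R ^ 8 * lap^[4] f (R • x) := by
  change lap (lap (lap (lap (fun x => f (R • x))))) = fun x => R ^ 8 * lap (lap (lap (lap f))) (R • x)
  rw [lap_lap_comp_smul hf, lap_const_mul (hf.lap.lap.comp_smul R),
    lap_const_mul (hf.lap.lap.comp_smul R).lap, lap_lap_comp_smul hf.lap.lap]
  funext x; ring

lemma integral_comp_smul_eq (hR : 0 < R) (F : EuclideanSpace ℝ (Fin n) → ℝ) :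
    ∫ x, F x = R ^ n * ∫ x, F (R • x) := by
  rw [Measure.integral_comp_smul volume F R, finrank_euclideanSpace_fin, smul_eq_mul,
    abs_of_pos (by positivity), mul_inv_cancel_left₀ (by positivity)]

lemma integral_weight_comp_smul (hR : 0 < R) (m : ℕ) (F : EuclideanSpace ℝ (Fin n) → ℝ) :
    ∫ y, ζ (R⁻¹ • y) ^ (2 * m) * F y = R ^ n * wInt ζ m (fun x => F (R • x)) := by
  rw [integral_comp_smul_eq hR, wInt]
  simp [smul_smul, inv_mul_cancel₀ hR.ne']

/-- The integral over the annulus `R ≤ |y| ≤ 2 R`. -/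
noncomputable def annInt (F : EuclideanSpace ℝ (Fin n) → ℝ) (R : ℝ) : ℝ :=
  ∫ y in {y | R ≤ ‖y‖ ∧ ‖y‖ ≤ 2 * R}, F y

lemma annInt_eq (hR : 0 < R) (F : EuclideanSpace ℝ (Fin n) → ℝ) :
    annInt F R = R ^ n * ∫ x in annulus n, F (R • x) := by
  have hm : MeasurableSet {y : EuclideanSpace ℝ (Fin n) | R ≤ ‖y‖ ∧ ‖y‖ ≤ 2 * R} :=
    ((isClosed_le continuous_const continuous_norm).inter
      (isClosed_le continuous_norm continuous_const)).measurableSet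
  rw [annInt, ← integral_indicator hm, ← integral_indicator measurableSet_annulus,
    integral_comp_smul_eq hR]
  congr 2; funext x
  have : R • x ∈ {y : EuclideanSpace ℝ (Fin n) | R ≤ ‖y‖ ∧ ‖y‖ ≤ 2 * R} ↔ x ∈ annulus n := by
    simp only [annulus, Set.mem_ofPred_eq, norm_smul, Real.norm_eq_abs, abs_of_pos hR]
    rw [mul_comm 2 R, mul_le_mul_iff_right₀ hR]
    exact and_congr_left fun _ => ⟨fun h => by nlinarith, fun h => by nlinarith⟩
  by_cases hx : x ∈ annulus n
  · rw [Set.indicator_of_mem hx, Set.indicator_of_mem (this.2 hx)]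
  · rw [Set.indicator_of_notMem hx, Set.indicator_of_notMem (fun h => hx (this.1 h))]

/-- The weighted integral at scale `R`. -/
noncomputable def scaled (ζ : EuclideanSpace ℝ (Fin n) → ℝ) (m : ℕ)
    (F : EuclideanSpace ℝ (Fin n) → ℝ) (R : ℝ) : ℝ :=
  ∫ y, ζ (R⁻¹ • y) ^ (2 * m) * F y

/-- The rescaled zeroth-order term. -/
noncomputable def lowTerm (ζ u : EuclideanSpace ℝ (Fin n) → ℝ) (t : ℕ) (R : ℝ) : ℝ :=
  R ^ n / R ^ 8 * gradInt ζ t 0 (fun x => u (R • x))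

lemma scaled_bilaplacian (hR : 0 < R) (hu : Smooth u) (m : ℕ) :
    scaled ζ m (fun x => lap (lap u) x ^ 2) R
      = R ^ n / R ^ 8 * wInt ζ m (fun x => lap (lap (fun x => u (R • x))) x ^ 2) := by
  rw [scaled, integral_weight_comp_smul hR, lap_lap_comp_smul hu]
  simp_rw [mul_pow]
  rw [wInt_const_mul]
  field_simp

lemma scaled_rpow (hR : 0 < R) (q : ℝ) (m : ℕ) :
    scaled ζ m (fun x => |u x| ^ q) R
      = R ^ n / R ^ 8 * (R ^ 8 * wInt ζ m (fun x => |u (R • x)| ^ q)) := by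
  rw [scaled, integral_weight_comp_smul hR]
  field_simp

lemma lowTerm_nonneg (hζ : IsCutoff ζ) (hR : 0 < R) (t : ℕ) : 0 ≤ lowTerm ζ u t R :=
  mul_nonneg (by positivity) (gradInt_nonneg hζ _ _ _)

lemma annInt_bilaplacian (hR : 0 < R) (hu : Smooth u) :
    annInt (fun x => lap (lap u) x ^ 2) R = R ^ n / R ^ 8
      * ∫ x in annulus n, lap (lap (fun x => u (R • x))) x ^ 2 := by
  rw [annInt_eq hR, lap_lap_comp_smul hu]
  simp_rw [mul_pow]
  rw [integral_const_mul]
  field_simp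

lemma annInt_rpow (hR : 0 < R) (q : ℝ) :
    annInt (fun x => |u x| ^ q) R = R ^ n / R ^ 8
      * (R ^ 8 * ∫ x in annulus n, |u (R • x)| ^ q) := by
  rw [annInt_eq hR]
  field_simp

lemma lap_four_scaled (heq : ∀ x, lap^[4] u x = |u x| ^ (p - 1) * u x)
    (hu : Smooth u) (R : ℝ) (x : EuclideanSpace ℝ (Fin n)) :
    lap^[4] (fun x => u (R • x)) x = R ^ 8 * (|u (R • x)| ^ (p - 1) * u (R • x)) := by
  rw [lap_four_comp_smul hu]
  simp only [heq]

lemma exists_scaled_energy (heq : ∀ x, lap^[4] u x = |u x| ^ (p - 1) * u x)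
    (hζ : IsCutoff ζ) {t : ℕ} (ht : t ≠ 0) {ε : ℝ} (hε : 0 < ε)
    (hp : 1 < p) (hu : Smooth u) : ∃ C ≥ 0, ∀ R > 0,
      |scaled ζ (t + 4) (fun x => |u x| ^ (p + 1)) R
        - scaled ζ (t + 4) (fun x => lap (lap u) x ^ 2) R| ≤
      ε * scaled ζ (t + 4) (fun x => lap (lap u) x ^ 2) R + C * lowTerm ζ u t R := by
  obtain ⟨C, hC, h⟩ := exists_abs_energy_solution_le hζ ht hε hp
  refine ⟨C, hC, fun R hR => ?_⟩
  have hk : 0 ≤ R ^ n / R ^ 8 := by positivity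
  have := mul_le_mul_of_nonneg_left
    (h (R ^ 8) _ (hu.comp_smul R) (lap_four_scaled heq hu R)) hk
  rw [scaled_bilaplacian hR hu, scaled_rpow hR, lowTerm, ← mul_sub, abs_mul, abs_of_nonneg hk]
  linarith

lemma exists_scaled_pohozaev (heq : ∀ x, lap^[4] u x = |u x| ^ (p - 1) * u x)
    (hζ : IsCutoff ζ) {t : ℕ} (ht : t ≠ 0) {ε : ℝ} (hε : 0 < ε)
    (hp : 1 < p) (hu : Smooth u) : ∃ C ≥ 0, ∀ R > 0,
      |((n : ℝ) / 2 - 4) * scaled ζ (t + 5) (fun x => lap (lap u) x ^ 2) R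
        - n / (p + 1) * scaled ζ (t + 5) (fun x => |u x| ^ (p + 1)) R| ≤
      ε * (scaled ζ (t + 4) (fun x => lap (lap u) x ^ 2) R + lowTerm ζ u t R)
        + C * (annInt (fun x => lap (lap u) x ^ 2) R + annInt (fun x => |u x| ^ (p + 1)) R) := by
  obtain ⟨C, hC, h⟩ := exists_abs_pohozaev_solution_le hζ ht hε hp
  refine ⟨C, hC, fun R hR => ?_⟩
  have hk : 0 ≤ R ^ n / R ^ 8 := by positivity
  have := mul_le_mul_of_nonneg_left
    (h (R ^ 8) _ (by positivity) (hu.comp_smul R) (lap_four_scaled heq hu R)) hk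
  rw [scaled_bilaplacian hR hu, scaled_bilaplacian hR hu, scaled_rpow hR, lowTerm,
    annInt_bilaplacian hR hu, annInt_rpow hR]
  rw [← abs_of_nonneg hk, ← abs_mul, abs_of_nonneg hk] at this
  refine (le_of_eq ?_).trans (this.trans_eq ?_)
  · congr 1; ring
  · ring

lemma exists_lowTerm_le (hζ : IsCutoff ζ) {t : ℕ} (ht : 8 ≤ t * (p - 1)) (hp : 1 < p)
    {d : ℝ} (hd : 0 < d) (hu : Smooth u) : ∃ C ≥ 0, ∀ R > 0,
      lowTerm ζ u t R ≤ d * scaled ζ (t + 4) (fun x => |u x| ^ (p + 1)) R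
        + C * R ^ ((n : ℝ) - 8 - 16 / (p - 1)) := by
  refine ⟨d ^ (-2 / (p - 1)) * volume.real (Metric.closedBall (0 : EuclideanSpace ℝ (Fin n)) 2),
    by positivity, fun R hR => ?_⟩
  have hk : 0 ≤ R ^ n / R ^ 8 := by positivity
  have := mul_le_mul_of_nonneg_left (gradInt_zero_le hζ ht hp (d := d * R ^ 8) (by positivity)
    (hu.comp_smul R)) hk
  rw [scaled_rpow hR, lowTerm]
  refine this.trans_eq ?_
  have e : R ^ n / R ^ 8 * (d * R ^ 8) ^ (-2 / (p - 1))
      = d ^ (-2 / (p - 1)) * R ^ ((n : ℝ) - 8 - 16 / (p - 1)) := by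
    rw [mul_rpow hd.le (by positivity), ← rpow_natCast R 8, ← rpow_natCast R n, ← rpow_mul hR.le,
      ← rpow_sub hR, mul_left_comm, ← rpow_add hR]
    congr 2; push_cast; ring
  rw [mul_add, ← mul_assoc _ ((d * R ^ 8) ^ (-2 / (p - 1))), e]
  ring

end Scaling

section Stability

variable {ζ f u : EuclideanSpace ℝ (Fin n) → ℝ} {p R : ℝ}

lemma integral_cutoff_scaled (hζ : IsCutoff ζ) (hu : Smooth u) (hR : 0 < R) (m : ℕ) :
    ∫ y, lap (lap (fun y => u y * ζ (R⁻¹ • y) ^ m)) y ^ 2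
      = R ^ n / R ^ 8 * ∫ x, lap (lap (fun x => u (R • x) * ζ x ^ m)) x ^ 2 := by
  have hs : Smooth (fun y => u y * ζ (R⁻¹ • y) ^ m) :=
    hu.mul ((hζ.smooth.comp_smul R⁻¹).pow m)
  have h := lap_lap_comp_smul hs R
  simp only [smul_smul, inv_mul_cancel₀ hR.ne', one_smul] at h
  rw [integral_comp_smul_eq hR, h]
  simp_rw [mul_pow]
  rw [integral_const_mul]
  field_simp

/-- Testing stability with a function cut off near the compact set. -/
lemma exists_stability_cutoff (hζ : IsCutoff ζ) {m : ℕ} (hm : m ≠ 0) (hp : 1 < p)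
    (hu : Smooth u) {K : Set (EuclideanSpace ℝ (Fin n))} (hK : IsCompact K)
    (hst : ∀ φ : EuclideanSpace ℝ (Fin n) → ℝ, ContDiff ℝ (⊤ : ℕ∞) φ → HasCompactSupport φ →
      tsupport φ ⊆ Kᶜ →
      p * ∫ x, |u x| ^ (p - 1) * (φ x) ^ 2 ≤ ∫ x, (lap^[2] φ x) ^ 2) :
    ∃ C₀ : ℝ, ∃ R₁ > 0, ∀ R ≥ R₁, p * scaled ζ m (fun x => |u x| ^ (p + 1)) R ≤
      (∫ y, lap (lap (fun y => u y * ζ (R⁻¹ • y) ^ m)) y ^ 2) + C₀ := by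
  obtain ⟨r₀, hr₀⟩ := hK.isBounded.subset_closedBall 0
  set r := max r₀ 0
  have hr : 0 ≤ r := le_max_right _ _
  have hKr : K ⊆ Metric.closedBall 0 r :=
    hr₀.trans (Metric.closedBall_subset_closedBall (le_max_left _ _))
  let θ : ContDiffBump (0 : EuclideanSpace ℝ (Fin n)) := ⟨r + 1, r + 2, by linarith, by linarith⟩
  have hθ : Smooth (θ : EuclideanSpace ℝ (Fin n) → ℝ) := θ.contDiff
  have hθ1 : ∀ y, ‖y‖ ≤ r + 1 → θ y = 1 := fun y hy =>
    θ.one_of_mem_closedBall (by simpa using hy)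
  have hθ0 : ∀ y, r + 2 ≤ ‖y‖ → θ y = 0 := fun y hy =>
    θ.zero_of_le_dist (by simpa using hy)
  set uθ : EuclideanSpace ℝ (Fin n) → ℝ := fun y => u y * θ y with huθ_def
  have huθ : Smooth uθ := hu.mul hθ
  have huθc : HasCompactSupport uθ := θ.hasCompactSupport.mul_left
  have hLc : HasCompactSupport (lap (lap uθ)) :=
    hasCompactSupport_lap (hasCompactSupport_lap huθc huθ) huθ.lap
  set A := ∫ y, ((-2) * (lap (lap u) y * lap (lap uθ) y) + lap (lap uθ) y * lap (lap uθ) y)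
  set B := ∫ y, |u y| ^ (p + 1) * (-2 * θ y + θ y ^ 2)
  refine ⟨A - p * B, r + 3, by linarith, fun R hR => ?_⟩
  have hR0 : 0 < R := by linarith
  have hη1 : ∀ y : EuclideanSpace ℝ (Fin n), ‖y‖ ≤ r + 3 → ζ (R⁻¹ • y) = 1 := by
    intro y hy
    apply hζ.eq_one
    rw [norm_smul, norm_inv, Real.norm_eq_abs, abs_of_pos hR0, inv_mul_le_iff₀ hR0]
    linarith
  have hη : Smooth (fun y => ζ (R⁻¹ • y) ^ m) := (hζ.smooth.comp_smul R⁻¹).pow m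
  have hηc : HasCompactSupport (fun y => ζ (R⁻¹ • y) ^ m) := by
    refine HasCompactSupport.intro (isCompact_closedBall 0 (2 * R)) fun y hy => ?_
    rw [hζ.eq_zero, zero_pow hm]
    rw [norm_smul, norm_inv, Real.norm_eq_abs, abs_of_pos hR0, le_inv_mul_iff₀ hR0]
    simp only [Metric.mem_closedBall, dist_zero_right, not_le] at hy
    linarith
  set uη : EuclideanSpace ℝ (Fin n) → ℝ := fun y => u y * ζ (R⁻¹ • y) ^ m with huη_def
  have huη : Smooth uη := hu.mul hη
  have huηc : HasCompactSupport uη := hηc.mul_left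
  have hLηc : HasCompactSupport (lap (lap uη)) :=
    hasCompactSupport_lap (hasCompactSupport_lap huηc huη) huη.lap
  have hηθ : ∀ y, ζ (R⁻¹ • y) ^ m * θ y = θ y := by
    intro y
    rcases le_total ‖y‖ (r + 3) with h | h
    · rw [hη1 y h, one_pow, one_mul]
    · rw [hθ0 y (by linarith), mul_zero]
  have hL : ∀ y, lap (lap uη) y * lap (lap uθ) y = lap (lap u) y * lap (lap uθ) y := by
    intro y
    rcases lt_or_ge ‖y‖ (r + 3) with h | h
    · have e : Set.EqOn uη u (Metric.ball 0 (r + 3)) := by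
        intro z hz
        simp [huη_def, hη1 z (by simpa using (Metric.mem_ball.1 hz).le)]
      rw [lap_congr Metric.isOpen_ball (lap_congr Metric.isOpen_ball e huη hu) huη.lap hu.lap
        (by simpa using h)]
    · have e : Set.EqOn uθ (fun _ => 0 * u y) (Metric.closedBall 0 (r + 2))ᶜ := by
        intro z hz
        simp only [Set.mem_compl_iff, Metric.mem_closedBall, dist_zero_right, not_le] at hz
        simp [huθ_def, hθ0 z hz.le]
      have ho : IsOpen (Metric.closedBall (0 : EuclideanSpace ℝ (Fin n)) (r + 2))ᶜ :=
        Metric.isClosed_closedBall.isOpen_compl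
      rw [lap_congr ho (lap_congr ho e huθ (Smooth.const _)) huθ.lap (Smooth.const _).lap
        (by simp only [Set.mem_compl_iff, Metric.mem_closedBall, dist_zero_right, not_le]; linarith),
        lap_const_mul (Smooth.const _), lap_const_mul (Smooth.const _).lap]
      simp
  have hφ : Smooth (fun y => uη y - uθ y) := huη.sub huθ
  have hφc : HasCompactSupport (fun y => uη y - uθ y) := huηc.sub huθc
  have hφK : tsupport (fun y => uη y - uθ y) ⊆ Kᶜ := by
    have : tsupport (fun y => uη y - uθ y) ⊆ (Metric.ball 0 (r + 1))ᶜ := by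
      refine closure_minimal (fun y hy => ?_) Metric.isOpen_ball.isClosed_compl
      intro hy'
      have hy1 : ‖y‖ < r + 1 := by simpa using hy'
      apply hy
      simp [huη_def, huθ_def, hη1 y (by linarith), hθ1 y hy1.le]
    refine this.trans (Set.compl_subset_compl.2 (hKr.trans ?_))
    exact Metric.closedBall_subset_ball (by linarith)
  have key := hst _ hφ hφc hφK
  have e1 : ∫ x, (lap^[2] (fun y => uη y - uθ y) x) ^ 2 = (∫ y, lap (lap uη) y ^ 2) + A := by
    rw [← integral_add]
    · congr 1; funext y
      change lap (lap (fun y => uη y - uθ y)) y ^ 2 = _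
      rw [lap_sub huη huθ, lap_sub huη.lap huθ.lap, ← hL y]
      ring
    · simp only [sq]
      exact huη.lap.lap.integrable_mul huη.lap.lap hLηc
    · exact ((hu.lap.lap.integrable_mul huθ.lap.lap hLc).const_mul _).add
        (huθ.lap.lap.integrable_mul huθ.lap.lap hLc)
  have hGc := hu.continuous_abs_rpow hp
  have e2 : ∫ x, |u x| ^ (p - 1) * (uη x - uθ x) ^ 2
      = scaled ζ m (fun x => |u x| ^ (p + 1)) R + B := by
    rw [scaled, ← integral_add]
    · congr 1; funext y
      rw [← abs_rpow_mul_self_mul_self hp]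
      simp only [huη_def, huθ_def]
      linear_combination (-2 * (|u y| ^ (p - 1) * u y * u y)) * hηθ y
    · refine ((hη.pow 2).continuous.mul hGc).integrable_of_hasCompactSupport ?_ |>.congr
        (Filter.Eventually.of_forall fun y => ?_)
      · exact HasCompactSupport.mul_right (hηc.comp_left (g := fun t : ℝ => t ^ 2) (by simp))
      · simp only [Pi.mul_apply, ← pow_mul, mul_comm m 2]
    · refine (hGc.mul (((continuous_const.mul hθ.continuous).add
        (hθ.pow 2).continuous))).integrable_of_hasCompactSupport ?_
      exact HasCompactSupport.mul_left (θ.hasCompactSupport.mul_left.add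
        (θ.hasCompactSupport.comp_left (g := fun t : ℝ => t ^ 2) (by simp)))
  rw [e1, e2] at key
  linarith

lemma exists_scaled_stability (hζ : IsCutoff ζ) {t : ℕ} (ht : t ≠ 0) {ε : ℝ} (hε : 0 < ε)
    (hp : 1 < p) (hu : Smooth u) {K : Set (EuclideanSpace ℝ (Fin n))} (hK : IsCompact K)
    (hst : ∀ φ : EuclideanSpace ℝ (Fin n) → ℝ, ContDiff ℝ (⊤ : ℕ∞) φ → HasCompactSupport φ →
      tsupport φ ⊆ Kᶜ →
      p * ∫ x, |u x| ^ (p - 1) * (φ x) ^ 2 ≤ ∫ x, (lap^[2] φ x) ^ 2) :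
    ∃ C ≥ 0, ∃ C₀ : ℝ, ∃ R₁ > 0, ∀ R ≥ R₁,
      p * scaled ζ (t + 4) (fun x => |u x| ^ (p + 1)) R ≤
        (1 + ε) * scaled ζ (t + 4) (fun x => lap (lap u) x ^ 2) R + C * lowTerm ζ u t R + C₀ := by
  obtain ⟨C, hC, h⟩ := exists_integral_bilaplacian_cutoff_sq_le hζ ht hε
  obtain ⟨C₀, R₁, hR₁, h'⟩ := exists_stability_cutoff hζ (m := t + 4) (by omega) hp hu hK hst
  refine ⟨C, hC, C₀, R₁, hR₁, fun R hR => ?_⟩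
  have hR0 : 0 < R := lt_of_lt_of_le hR₁ hR
  have h1 := h' R hR
  rw [integral_cutoff_scaled hζ hu hR0] at h1
  have h2 := mul_le_mul_of_nonneg_left (h _ (hu.comp_smul R))
    (show 0 ≤ R ^ n / R ^ 8 by positivity)
  rw [scaled_bilaplacian hR0 hu, lowTerm]
  linarith

end Stability

section Limits

open Filter Topology

variable {ζ F u : EuclideanSpace ℝ (Fin n) → ℝ} {p R : ℝ}

lemma scaled_nonneg (hζ : IsCutoff ζ) (m : ℕ) (hF0 : ∀ x, 0 ≤ F x) (R : ℝ) :
    0 ≤ scaled ζ m F R :=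
  integral_nonneg fun _ => mul_nonneg (pow_nonneg (hζ.nonneg _) _) (hF0 _)

lemma setIntegral_closedBall_le_scaled (hζ : IsCutoff ζ) {m : ℕ} (hm : m ≠ 0) (hF : Continuous F)
    (hF0 : ∀ x, 0 ≤ F x) (hR : 0 < R) :
    ∫ x in Metric.closedBall 0 R, F x ≤ scaled ζ m F R := by
  have hi : Integrable (fun y => ζ (R⁻¹ • y) ^ (2 * m) * F y) := by
    refine ((((hζ.smooth.comp_smul R⁻¹).pow (2 * m)).continuous).mul
      hF).integrable_of_hasCompactSupport ?_
    refine HasCompactSupport.intro (isCompact_closedBall 0 (2 * R)) fun y hy => ?_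
    simp only [Metric.mem_closedBall, dist_zero_right, not_le] at hy
    rw [Pi.mul_apply, hζ.eq_zero, zero_pow (by omega), zero_mul]
    rw [norm_smul, norm_inv, Real.norm_eq_abs, abs_of_pos hR, le_inv_mul_iff₀ hR]
    linarith
  refine le_trans (le_of_eq ?_) (setIntegral_le_integral hi (s := Metric.closedBall 0 R)
    (Eventually.of_forall fun _ => mul_nonneg (pow_nonneg (hζ.nonneg _) _) (hF0 _)))
  refine setIntegral_congr_fun Metric.isClosed_closedBall.measurableSet fun y hy => ?_
  have hy' : ‖R⁻¹ • y‖ ≤ 1 := by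
    rw [norm_smul, norm_inv, Real.norm_eq_abs, abs_of_pos hR, inv_mul_le_iff₀ hR]
    simpa using hy
  simp [hζ.eq_one _ hy']

lemma integrable_of_scaled_le (hζ : IsCutoff ζ) {m : ℕ} (hm : m ≠ 0) (hF : Continuous F)
    (hF0 : ∀ x, 0 ≤ F x) {M : ℝ} (h : ∀ᶠ R in atTop, scaled ζ m F R ≤ M) : Integrable F := by
  refine (aecover_closedBall (x := (0 : EuclideanSpace ℝ (Fin n)))
    tendsto_id).integrable_of_integral_bounded_of_nonneg_ae (l := atTop) M
    (fun R => hF.continuousOn.integrableOn_compact (isCompact_closedBall _ _))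
    (Eventually.of_forall hF0) ?_
  filter_upwards [h, eventually_gt_atTop 0] with R hR hR0
  exact (setIntegral_closedBall_le_scaled hζ hm hF hF0 hR0).trans hR

lemma tendsto_annInt (hF : Integrable F) : Tendsto (annInt F) atTop (𝓝 0) := by
  have hm : ∀ R : ℝ, MeasurableSet {y : EuclideanSpace ℝ (Fin n) | R ≤ ‖y‖ ∧ ‖y‖ ≤ 2 * R} :=
    fun R => ((isClosed_le continuous_const continuous_norm).inter
      (isClosed_le continuous_norm continuous_const)).measurableSet
  have e : annInt F = fun R => ∫ y, {y | R ≤ ‖y‖ ∧ ‖y‖ ≤ 2 * R}.indicator F y := by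
    funext R
    rw [annInt, integral_indicator (hm R)]
  rw [e, show (0 : ℝ) = ∫ _ : EuclideanSpace ℝ (Fin n), (0 : ℝ) by simp]
  refine tendsto_integral_filter_of_dominated_convergence (fun y => ‖F y‖)
    (Eventually.of_forall fun R => hF.aestronglyMeasurable.indicator (hm R))
    (Eventually.of_forall fun R => Eventually.of_forall fun y => norm_indicator_le_norm_self _ _)
    hF.norm (Eventually.of_forall fun y => ?_)
  refine tendsto_const_nhds.congr' ?_
  filter_upwards [eventually_gt_atTop ‖y‖] with R hR
  rw [Set.indicator_of_notMem]
  exact fun h => absurd h.1 (not_le.2 hR)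

lemma exponent_neg (hn : 9 ≤ n) (hp : 1 < p) (hp2 : p < ((n : ℝ) + 8) / ((n : ℝ) - 8)) :
    (n : ℝ) - 8 - 16 / (p - 1) < 0 := by
  have hn' : (9 : ℝ) ≤ n := by exact_mod_cast hn
  rw [lt_div_iff₀ (by linarith)] at hp2
  rw [sub_neg, lt_div_iff₀ (by linarith)]
  linarith

/-- Closing the energy and stability inequalities on each other. -/
lemma energy_le_of_energy_of_stability {A B g p ε C₁ C₂ C₀ : ℝ} (hε : 0 < ε) (hε2 : ε < 1 / 2)
    (hεp : ε * (p + 1) = (p - 1) / 2) (hC₁ : 0 ≤ C₁) (hC₂ : 0 ≤ C₂) (hg : 0 ≤ g)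
    (h1 : (1 - ε) * A ≤ B + C₁ * g) (h2 : p * B ≤ (1 + ε) * A + C₂ * g + C₀) :
    (p - 1) / 2 * B ≤ (2 * C₁ + C₂) * g + |C₀| := by
  have s1 := mul_le_mul_of_nonneg_left h2 (show 0 ≤ 1 - ε by linarith)
  have s2 := mul_le_mul_of_nonneg_left h1 (show 0 ≤ 1 + ε by linarith)
  have s3 : (1 - ε) * C₀ ≤ |C₀| :=
    (mul_le_mul_of_nonneg_left (le_abs_self C₀) (by linarith)).trans
      (mul_le_of_le_one_left (abs_nonneg C₀) (by linarith))
  have s4 : (1 + ε) * (C₁ * g) ≤ 2 * (C₁ * g) :=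
    mul_le_mul_of_nonneg_right (by linarith) (by positivity)
  have s5 : (1 - ε) * (C₂ * g) ≤ C₂ * g :=
    mul_le_of_le_one_left (by positivity) (by linarith)
  linear_combination s1 + s2 + s3 + s4 + s5 + B * hεp

/-- The rescaled energies of a solution stable outside a compact set stay bounded. -/
lemma exists_scaled_bound (heq : ∀ x, lap^[4] u x = |u x| ^ (p - 1) * u x) (hζ : IsCutoff ζ)
    (hn : 9 ≤ n) (hp : 1 < p) (hp2 : p < ((n : ℝ) + 8) / ((n : ℝ) - 8)) (hu : Smooth u)
    {K : Set (EuclideanSpace ℝ (Fin n))} (hK : IsCompact K)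
    (hst : ∀ φ : EuclideanSpace ℝ (Fin n) → ℝ, ContDiff ℝ (⊤ : ℕ∞) φ → HasCompactSupport φ →
      tsupport φ ⊆ Kᶜ →
      p * ∫ x, |u x| ^ (p - 1) * (φ x) ^ 2 ≤ ∫ x, (lap^[2] φ x) ^ 2)
    {t : ℕ} (ht : 8 ≤ t * (p - 1)) :
    ∃ M ≥ 0, ∀ᶠ R in atTop, scaled ζ (t + 4) (fun x => |u x| ^ (p + 1)) R ≤ M ∧
      scaled ζ (t + 4) (fun x => lap (lap u) x ^ 2) R ≤ M := by
  have ht0 : t ≠ 0 := by rintro rfl; norm_num at ht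
  have hp' : 0 < p - 1 := by linarith
  set ε := (p - 1) / (2 * (p + 1)) with hε_def
  have hε : 0 < ε := by positivity
  have hε2 : ε < 1 / 2 := by
    rw [hε_def, div_lt_iff₀ (by linarith)]; linarith
  have hεp : ε * (p + 1) = (p - 1) / 2 := by rw [hε_def]; field_simp
  obtain ⟨C₁, hC₁, h1⟩ := exists_scaled_energy heq hζ ht0 hε hp hu
  obtain ⟨C₂, hC₂, C₀, R₁, hR₁, h2⟩ := exists_scaled_stability hζ ht0 hε hp hu hK hst
  set D := 2 * C₁ + C₂ with hD
  have hD0 : 0 ≤ D := by positivity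
  set d := (p - 1) / (4 * (D + 1)) with hd_def
  have hd : 0 < d := by positivity
  have hDd : D * d ≤ (p - 1) / 4 := by
    rw [hd_def, mul_div_assoc', div_le_div_iff₀ (by positivity) (by norm_num)]
    nlinarith
  obtain ⟨C₃, hC₃, h3⟩ := exists_lowTerm_le hζ ht hp hd hu
  set MB := 4 / (p - 1) * (D * C₃ + |C₀|) with hMB
  have hMB0 : 0 ≤ MB := by positivity
  set MA := 2 * (MB + C₁ * (d * MB + C₃)) with hMA
  have hMA0 : 0 ≤ MA := by positivity
  refine ⟨MB + MA, by positivity, ?_⟩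
  filter_upwards [eventually_ge_atTop R₁, eventually_ge_atTop 1] with R hR hR1
  have hR0 : 0 < R := by linarith
  have a1 := (abs_le.1 (h1 R hR0)).1
  have a2 := h2 R hR
  have a3 := h3 R hR0
  have hRe : R ^ ((n : ℝ) - 8 - 16 / (p - 1)) ≤ 1 :=
    rpow_le_one_of_one_le_of_nonpos hR1 (exponent_neg hn hp hp2).le
  have hg := lowTerm_nonneg (u := u) hζ hR0 t
  have hA := scaled_nonneg (F := fun x => lap (lap u) x ^ 2) hζ (t + 4) (fun x => sq_nonneg _) R
  have hB := scaled_nonneg (F := fun x => |u x| ^ (p + 1)) hζ (t + 4)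
    (fun x => rpow_nonneg (abs_nonneg (u x)) _) R
  generalize scaled ζ (t + 4) (fun x => lap (lap u) x ^ 2) R = A at *
  generalize scaled ζ (t + 4) (fun x => |u x| ^ (p + 1)) R = B at *
  generalize lowTerm ζ u t R = g at *
  have a3' : g ≤ d * B + C₃ := a3.trans (by nlinarith)
  have a1' : (1 - ε) * A ≤ B + C₁ * g := by linarith
  have a4 : (p - 1) / 2 * B ≤ D * g + |C₀| :=
    energy_le_of_energy_of_stability hε hε2 hεp hC₁ hC₂ hg a1' (by linarith only [a2])
  have hBM : B ≤ MB := by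
    have s1 := mul_le_mul_of_nonneg_left a3' hD0
    have s2 := mul_le_mul_of_nonneg_right hDd hB
    rw [hMB, div_mul_eq_mul_div, le_div_iff₀ hp']
    linear_combination 4 * (a4 + s1 + s2)
  have hAM : A ≤ MA := by
    have s1 := mul_le_mul_of_nonneg_left (a3'.trans
      (add_le_add_left (mul_le_mul_of_nonneg_left hBM hd.le) C₃)) hC₁
    have s2 := mul_le_mul_of_nonneg_right hε2.le hA
    rw [hMA]
    linear_combination 2 * (a1' + s1 + hBM + s2)
  exact ⟨hBM.trans (le_add_of_nonneg_right hMA0), hAM.trans (le_add_of_nonneg_left hMB0)⟩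

lemma tendsto_lowTerm (hζ : IsCutoff ζ) (hn : 9 ≤ n) (hp : 1 < p)
    (hp2 : p < ((n : ℝ) + 8) / ((n : ℝ) - 8)) (hu : Smooth u) {t : ℕ} (ht : 8 ≤ t * (p - 1))
    {M : ℝ} (hM0 : 0 ≤ M)
    (hM : ∀ᶠ R in atTop, scaled ζ (t + 4) (fun x => |u x| ^ (p + 1)) R ≤ M) :
    Tendsto (lowTerm ζ u t) atTop (𝓝 0) := by
  refine tendsto_order.2 ⟨fun a ha => ?_, fun a ha => ?_⟩
  · filter_upwards [eventually_gt_atTop 0] with R hR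
    exact ha.trans_le (lowTerm_nonneg hζ hR t)
  · have hd : 0 < a / (2 * (M + 1)) := by positivity
    obtain ⟨C, hC, h⟩ := exists_lowTerm_le hζ ht hp hd hu
    have hlim : Tendsto (fun R : ℝ => C * R ^ ((n : ℝ) - 8 - 16 / (p - 1))) atTop (𝓝 (C * 0)) := by
      have := (tendsto_rpow_neg_atTop (neg_pos.2 (exponent_neg hn hp hp2))).const_mul C
      simpa using this
    rw [mul_zero] at hlim
    filter_upwards [hM, eventually_gt_atTop 0, hlim.eventually_lt_const (half_pos ha)]
      with R h1 h2 h3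
    refine (h R h2).trans_lt ?_
    have h4 := mul_le_mul_of_nonneg_left h1 hd.le
    have h5 : a / (2 * (M + 1)) * M ≤ a / 2 := by
      rw [div_mul_eq_mul_div, div_le_div_iff₀ (by positivity) (by norm_num)]
      nlinarith
    linarith

lemma exists_isCutoff (n : ℕ) : ∃ ζ : EuclideanSpace ℝ (Fin n) → ℝ, IsCutoff ζ := by
  let χ : ContDiffBump (0 : EuclideanSpace ℝ (Fin n)) := ⟨1, 2, by norm_num, by norm_num⟩
  exact ⟨χ, χ.contDiff, fun x => χ.nonneg, fun x => χ.le_one,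
    fun x hx => χ.one_of_mem_closedBall (by simpa using hx),
    fun x hx => χ.zero_of_le_dist (by simpa using hx)⟩

/-- A solution stable outside a compact set vanishes identically. -/
theorem eq_zero_of_stable_outside_compact (hn : 9 ≤ n) (hp1 : 1 < p)
    (hp2 : p < ((n : ℝ) + 8) / ((n : ℝ) - 8)) (hu : Smooth u)
    (heq : ∀ x, lap^[4] u x = |u x| ^ (p - 1) * u x)
    {K : Set (EuclideanSpace ℝ (Fin n))} (hK : IsCompact K)
    (hst : ∀ φ : EuclideanSpace ℝ (Fin n) → ℝ, ContDiff ℝ (⊤ : ℕ∞) φ → HasCompactSupport φ →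
      tsupport φ ⊆ Kᶜ →
      p * ∫ x, |u x| ^ (p - 1) * (φ x) ^ 2 ≤ ∫ x, (lap^[2] φ x) ^ 2) :
    ∀ x, u x = 0 := by
  obtain ⟨ζ, hζ⟩ := exists_isCutoff n
  have hp' : 0 < p - 1 := by linarith
  obtain ⟨t, ht⟩ := exists_nat_ge (8 / (p - 1))
  rw [div_le_iff₀ hp'] at ht
  have ht0 : t ≠ 0 := by rintro rfl; norm_num at ht
  have ht' : 8 ≤ ((t + 1 : ℕ) : ℝ) * (p - 1) := by push_cast; linarith
  have hn' : (9 : ℝ) ≤ n := by exact_mod_cast hn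
  obtain ⟨M, hM0, hM⟩ := exists_scaled_bound heq hζ hn hp1 hp2 hu hK hst ht
  obtain ⟨M', hM'0, hM'⟩ := exists_scaled_bound heq hζ hn hp1 hp2 hu hK hst ht'
  have hF0 : ∀ x, 0 ≤ |u x| ^ (p + 1) := fun x => rpow_nonneg (abs_nonneg (u x)) _
  have hFc : Continuous (fun x => |u x| ^ (p + 1)) := hu.continuous_abs_rpow hp1
  have hFi : Integrable (fun x => |u x| ^ (p + 1)) :=
    integrable_of_scaled_le hζ (by omega) hFc hF0 (hM.mono fun _ h => h.1)
  have hLi : Integrable (fun x => lap (lap u) x ^ 2) :=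
    integrable_of_scaled_le hζ (by omega) (hu.lap.lap.pow 2).continuous (fun x => sq_nonneg _)
      (hM.mono fun _ h => h.2)
  have hg := tendsto_lowTerm hζ hn hp1 hp2 hu ht hM0 (hM.mono fun _ h => h.1)
  have hg' := tendsto_lowTerm hζ hn hp1 hp2 hu ht' hM'0 (hM'.mono fun _ h => h.1)
  have hT := (tendsto_annInt hLi).add (tendsto_annInt hFi)
  set c := n / (p + 1) - ((n : ℝ) / 2 - 4) with hc_def
  have hc : 0 < c := by
    rw [lt_div_iff₀ (by linarith)] at hp2
    rw [hc_def, sub_pos, lt_div_iff₀ (by linarith)]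
    linarith
  have hball := (aecover_closedBall (x := (0 : EuclideanSpace ℝ (Fin n)))
    (μ := volume) (l := atTop) tendsto_id).integral_tendsto_of_countably_generated hFi
  have key : ∀ ε > 0, c * ∫ x, |u x| ^ (p + 1) ≤ ε * (((n : ℝ) / 2 - 4) * M' + M) := by
    intro ε hε
    obtain ⟨C₁, hC₁, h1⟩ := exists_scaled_energy heq hζ (t := t + 1) (by omega) hε hp1 hu
    obtain ⟨C₂, hC₂, h2⟩ := exists_scaled_pohozaev heq hζ ht0 hε hp1 hu
    have hlim := (((hg'.const_mul C₁).const_add (ε * M')).const_mul ((n : ℝ) / 2 - 4)).add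
      (((hg.const_add M).const_mul ε).add (hT.const_mul C₂))
    have hle := le_of_tendsto_of_tendsto (hball.const_mul c) hlim ?_
    · refine hle.trans_eq ?_
      ring
    · filter_upwards [hM, hM', eventually_gt_atTop 0] with R hMR hMR' hR
      have a0 := setIntegral_closedBall_le_scaled hζ (m := t + 5) (by omega) hFc hF0 hR
      have a1 := (abs_le.1 (h1 R hR)).1
      have a2 := (abs_le.1 (h2 R hR)).1
      have a3 := hMR.2
      have a4 := hMR'.2
      rw [show t + 1 + 4 = t + 5 by ring] at a1 a4
      have b1 : scaled ζ (t + 5) (fun x => lap (lap u) x ^ 2) R ≤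
          scaled ζ (t + 5) (fun x => |u x| ^ (p + 1)) R
            + (ε * M' + C₁ * lowTerm ζ u (t + 1) R) := by
        have := mul_le_mul_of_nonneg_left a4 hε.le
        linarith
      have b2 := mul_le_mul_of_nonneg_left b1 (show 0 ≤ (n : ℝ) / 2 - 4 by linarith)
      have b3 := mul_le_mul_of_nonneg_left a3 hε.le
      have b4 := mul_le_mul_of_nonneg_left a0 hc.le
      refine b4.trans ?_
      rw [hc_def]
      linarith
  have hzero : ∫ x, |u x| ^ (p + 1) = 0 := by
    refine le_antisymm ?_ (integral_nonneg hF0)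
    have : c * ∫ x, |u x| ^ (p + 1) ≤ 0 := by
      refine le_of_forall_pos_le_add fun δ hδ => ?_
      have hq : 0 ≤ ((n : ℝ) / 2 - 4) * M' + M :=
        add_nonneg (mul_nonneg (by linarith) hM'0) hM0
      refine (key (δ / (((n : ℝ) / 2 - 4) * M' + M + 1)) (by positivity)).trans ?_
      rw [zero_add, div_mul_eq_mul_div, div_le_iff₀ (by positivity)]
      nlinarith
    exact nonpos_of_mul_nonpos_right this hc
  have hae := (integral_eq_zero_iff_of_nonneg hF0 hFi).1 hzero
  have heq0 := (hFc.ae_eq_iff_eq volume continuous_const).1 hae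
  intro x
  have := congrFun heq0 x
  exact abs_eq_zero.1 ((rpow_eq_zero (abs_nonneg _) (by linarith)).1 this)

end Limits

end LaneEmden

/-- Liouville theorem for finite-Morse-index (stable outside a compact set) solutions of
`Δ⁴ u = |u|^{p-1} u` in `ℝⁿ` in the subcritical range `1 < p < (n+8)/(n-8)`. -/
theorem quadharmonic_LaneEmden_stable_outside_compact_subcritical
    (n : ℕ) (hn : 9 ≤ n) (p : ℝ) (hp1 : 1 < p) (hp2 : p < ((n : ℝ) + 8) / ((n : ℝ) - 8))
    (u : EuclideanSpace ℝ (Fin n) → ℝ) (hu : ContDiff ℝ (⊤ : ℕ∞) u)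
    (heq : ∀ x, lap^[4] u x = |u x| ^ (p - 1) * u x)
    (hstable : ∃ K : Set (EuclideanSpace ℝ (Fin n)), IsCompact K ∧
      ∀ φ : EuclideanSpace ℝ (Fin n) → ℝ, ContDiff ℝ (⊤ : ℕ∞) φ → HasCompactSupport φ →
        tsupport φ ⊆ Kᶜ →
        p * ∫ x, |u x| ^ (p - 1) * (φ x) ^ 2 ≤ ∫ x, (lap^[2] φ x) ^ 2) :
    ∀ x, u x = 0 := by
  obtain ⟨K, hK, hst⟩ := hstable
  exact LaneEmden.eq_zero_of_stable_outside_compact hn hp1 hp2 hu heq hK hst
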